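/- arXiv:2403.18777 — 2 statements merged into one kernel-verified Lean document; each statement's English description precedes it below -/
import Mathlib

section
/- There exist absolute constants c, c' > 0 such that the following holds. Let n, q ≥ 2, k ≥ 2 be integers with c'·q ≤ n, let ε ∈ (0, e^{-8}), and set s = ⌈c·(k·q³/ε)·ln²(kq/ε)⌉, assuming s ≤ n. Let φ be a q-uniform CSP over n variables with alphabet [k], and let S be a uniformly random s-element subset of the variables. Then: (i) if φ is satisfiable, the restriction φ[S] is satisfiable; and (ii) if φ is ε-far from satisfiable, then the probability that φ[S] is satisfiable is at most 1/3. (Consequently the sample complexity of ε-testing (q,k)-SAT is O((kq³/ε)·ln²(kq/ε)).) -/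
open Finset
open scoped Classical

/-- A `q`-uniform CSP over `n` variables with alphabet `[k]`: a finite set of constraints
`(T, P)` where `T` is a `q`-element set of variables and `P` is a predicate depending only on
the values of the variables in `T`, with at most one constraint per set `T`. -/
structure CSP (n q k : ℕ) where
  constraints : Finset ((Finset (Fin n)) × ((Fin n → Fin k) → Bool))
  uniform : ∀ c ∈ constraints, c.1.card = q
  unique : ∀ c ∈ constraints, ∀ c' ∈ constraints, c.1 = c'.1 → c = c'
  localPred : ∀ c ∈ constraints, ∀ A B : Fin n → Fin k,
    (∀ x ∈ c.1, A x = B x) → c.2 A = c.2 B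

/-- `φ` is satisfiable: some assignment falsifies no constraint. -/
def CSP.Satisfiable {n q k : ℕ} (φ : CSP n q k) : Prop :=
  ∃ A : Fin n → Fin k, ∀ c ∈ φ.constraints, c.2 A = true

/-- The restriction `φ[S]` (the constraints of `φ` all of whose variables lie in `S`)
is satisfiable. -/
def CSP.SatOn {n q k : ℕ} (φ : CSP n q k) (S : Finset (Fin n)) : Prop :=
  ∃ A : Fin n → Fin k, ∀ c ∈ φ.constraints, c.1 ⊆ S → c.2 A = true

/-- `φ` is `ε`-far from satisfiable: every assignment falsifies at least
`ε · (n choose q)` constraints. -/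
def CSP.EpsFar {n q k : ℕ} (φ : CSP n q k) (ε : ℝ) : Prop :=
  ∀ A : Fin n → Fin k,
    ε * (n.choose q : ℝ) ≤ ((φ.constraints.filter (fun c => c.2 A = false)).card : ℝ)


section Helpers

/-- Degree of a vertex in a set system. -/
noncomputable def hdeg {n : ℕ} (G : Finset (Finset (Fin n))) (u : Fin n) : ℕ :=
  (G.filter (fun T => u ∈ T)).card

/-- Link of a vertex. -/
noncomputable def hlink {n : ℕ} (G : Finset (Finset (Fin n))) (u : Fin n) :
    Finset (Finset (Fin n)) :=
  (G.filter (fun T => u ∈ T)).image (fun T => T.erase u)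

/-- Vertices of positive degree. -/
noncomputable def hsupp {n : ℕ} (G : Finset (Finset (Fin n))) : Finset (Fin n) :=
  Finset.univ.filter (fun y => 0 < hdeg G y)

/-- Sets of vertices which can be removed, given fingerprints inside `Q`. -/
noncomputable def reachR {n : ℕ} : ℕ → Finset (Finset (Fin n)) → Finset (Fin n) →
    Finset (Finset (Fin n))
  | 0, G, _ => {hsupp G}
  | m + 1, G, Q => insert (hsupp G) (Q.biUnion fun u => (reachR m (hlink G u) Q).image
      (fun R => Finset.univ.filter (fun y => hdeg G u < hdeg G y) ∪ R))

lemma reachR_mono {n : ℕ} (m : ℕ) : ∀ (G : Finset (Finset (Fin n))) {Q Q' : Finset (Fin n)},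
    Q ⊆ Q' → reachR m G Q ⊆ reachR m G Q' := by
  induction m with
  | zero => intro G Q Q' _; simp [reachR]
  | succ m ih =>
    intro G Q Q' h
    simp only [reachR]
    apply Finset.insert_subset_insert
    intro R hR
    simp only [Finset.mem_biUnion, Finset.mem_image] at hR ⊢
    obtain ⟨u, hu, R', hR', rfl⟩ := hR
    exact ⟨u, h hu, R', ih _ h hR', rfl⟩

lemma reachR_card {n : ℕ} (m : ℕ) : ∀ (G : Finset (Finset (Fin n))) (Q : Finset (Fin n)),
    (reachR m G Q).card ≤ (Q.card + 1) ^ m := by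
  induction m with
  | zero => intro G Q; simp [reachR]
  | succ m ih =>
    intro G Q
    simp only [reachR]
    refine (Finset.card_insert_le _ _).trans ?_
    have h1 : (Q.biUnion fun u => (reachR m (hlink G u) Q).image
      (fun R => Finset.univ.filter (fun y => hdeg G u < hdeg G y) ∪ R)).card
        ≤ Q.card * (Q.card + 1) ^ m := by
      apply Finset.card_biUnion_le_card_mul
      intro u _
      exact Finset.card_image_le.trans (ih _ _)
    have h2 : 1 ≤ (Q.card + 1) ^ m := Nat.one_le_pow _ _ (by omega)
    calc _ ≤ Q.card * (Q.card + 1) ^ m + 1 := by omega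
      _ ≤ Q.card * (Q.card + 1) ^ m + (Q.card + 1) ^ m := by omega
      _ = _ := by ring

lemma hlink_card {n : ℕ} (G : Finset (Finset (Fin n))) (u : Fin n) :
    (hlink G u).card = hdeg G u := by
  unfold hlink hdeg
  apply Finset.card_image_of_injOn
  intro T hT T' hT' h
  simp only [Finset.coe_filter, Set.mem_ofPred_eq] at hT hT'
  have h' : T.erase u = T'.erase u := h
  rw [← Finset.insert_erase hT.2, ← Finset.insert_erase hT'.2, h']

lemma hlink_unif {n m : ℕ} (G : Finset (Finset (Fin n))) (u : Fin n)
    (hG : ∀ T ∈ G, T.card = m + 1) : ∀ T ∈ hlink G u, T.card = m := by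
  intro T hT
  simp only [hlink, Finset.mem_image, Finset.mem_filter] at hT
  obtain ⟨T', ⟨h1, h2⟩, rfl⟩ := hT
  rw [Finset.card_erase_of_mem h2, hG _ h1]; rfl

lemma unif_card_le {n m : ℕ} (G : Finset (Finset (Fin n)))
    (hG : ∀ T ∈ G, T.card = m) : G.card * m.factorial ≤ n ^ m := by
  have h1 : G ⊆ Finset.powersetCard m Finset.univ := by
    intro T hT
    simp [Finset.mem_powersetCard, hG T hT]
  have h2 : G.card ≤ n.choose m := by
    simpa using Finset.card_le_card h1
  calc G.card * m.factorial ≤ n.choose m * m.factorial := Nat.mul_le_mul_right _ h2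
    _ = n.descFactorial m := by rw [Nat.descFactorial_eq_factorial_mul_choose, mul_comm]
    _ ≤ n ^ m := Nat.descFactorial_le_pow _ _

lemma sum_hdeg {n m : ℕ} (G : Finset (Finset (Fin n)))
    (hG : ∀ T ∈ G, T.card = m) : ∑ y, hdeg G y = m * G.card := by
  unfold hdeg
  simp only [Finset.card_filter]
  rw [Finset.sum_comm]
  rw [Finset.sum_congr rfl (g := fun _ => m)]
  · simp [mul_comm]
  · intro T hT
    rw [← hG T hT]
    simp

lemma hdeg_link_le {n : ℕ} (G : Finset (Finset (Fin n))) (u y : Fin n) :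
    0 < hdeg (hlink G u) y → 0 < hdeg G y := by
  unfold hdeg hlink
  simp only [Finset.card_pos]
  rintro ⟨T, hT⟩
  simp only [Finset.mem_filter, Finset.mem_image] at hT
  obtain ⟨⟨T', ⟨h1, h2⟩, rfl⟩, h3⟩ := hT
  exact ⟨T', by simp [h1, Finset.mem_of_mem_erase h3]⟩

lemma reachR_main {n : ℕ} (m : ℕ) : ∀ (G : Finset (Finset (Fin n)))
    (_ : ∀ T ∈ G, T.card = m + 1) (I : Finset (Fin n)) (_ : ∀ T ∈ G, ¬ T ⊆ I),
    ∃ Q ⊆ I, Q.card ≤ m ∧ ∃ R ∈ reachR m G Q, Disjoint R I ∧ R ⊆ hsupp G ∧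
      G.card * m.factorial ≤ R.card * n ^ m := by
  induction m with
  | zero =>
    intro G hG I hI
    refine ⟨∅, by simp, by simp, hsupp G, by simp [reachR], ?_, subset_rfl, ?_⟩
    · rw [Finset.disjoint_left]
      intro y hy hyI
      simp only [hsupp, hdeg, Finset.mem_filter, Finset.card_pos] at hy
      obtain ⟨T, hT⟩ := hy.2
      simp only [Finset.mem_filter] at hT
      apply hI T hT.1
      obtain ⟨z, rfl⟩ := Finset.card_eq_one.mp (by simpa using hG T hT.1)
      simp at hT ⊢
      rw [← hT.2]; exact hyI
    · simp only [Nat.factorial, pow_zero, mul_one]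
      have : G ⊆ (hsupp G).image (fun y => ({y} : Finset (Fin n))) := by
        intro T hT
        obtain ⟨z, rfl⟩ := Finset.card_eq_one.mp (by simpa using hG T hT)
        simp only [Finset.mem_image, hsupp, hdeg, Finset.mem_filter, Finset.card_pos]
        exact ⟨z, ⟨by simp, ⟨{z}, by simp [hT]⟩⟩, rfl⟩
      exact (Finset.card_le_card this).trans Finset.card_image_le
  | succ m ih =>
    intro G hG I hI
    have hdegle : ∀ y, hdeg G y * (m + 1).factorial ≤ n ^ (m + 1) := by
      intro y
      rw [← hlink_card]
      exact unif_card_le _ (hlink_unif G y hG)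
    have hsum := sum_hdeg G hG
    by_cases hc : ∀ u ∈ I, hdeg G u = 0
    · refine ⟨∅, by simp, by simp, hsupp G, by simp [reachR], ?_, subset_rfl, ?_⟩
      · rw [Finset.disjoint_left]
        intro y hy hyI
        simp only [hsupp, Finset.mem_filter] at hy
        have := hc y hyI
        omega
      · have h1 : ∑ y, hdeg G y = ∑ y ∈ hsupp G, hdeg G y := by
          unfold hsupp
          rw [Finset.sum_filter]
          apply Finset.sum_congr rfl
          intro y _
          split_ifs <;> omega
        have h2 : (∑ y ∈ hsupp G, hdeg G y) * (m + 1).factorial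
            ≤ (hsupp G).card * n ^ (m + 1) := by
          rw [Finset.sum_mul, ← smul_eq_mul]
          exact Finset.sum_le_card_nsmul _ _ _ (fun y _ => hdegle y)
        rw [← h1, hsum] at h2
        refine le_trans ?_ h2
        apply Nat.mul_le_mul_right
        nlinarith
    · push Not at hc
      obtain ⟨u0, hu0, hu0'⟩ := hc
      obtain ⟨u, hu, hmax⟩ := Finset.exists_max_image I (hdeg G) ⟨u0, hu0⟩
      obtain ⟨Q, hQI, hQc, R, hR, hRI, hRs, hcard⟩ := ih (hlink G u) (hlink_unif G u hG) I (by
        intro T hT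
        simp only [hlink, Finset.mem_image, Finset.mem_filter] at hT
        obtain ⟨T', ⟨h1, h2⟩, rfl⟩ := hT
        intro h3
        apply hI T' h1
        rw [← Finset.insert_erase h2]
        exact Finset.insert_subset hu h3)
      refine ⟨insert u Q, Finset.insert_subset hu hQI, (Finset.card_insert_le _ _).trans (by omega),
        Finset.univ.filter (fun y => hdeg G u < hdeg G y) ∪ R, ?_, ?_, ?_, ?_⟩
      · simp only [reachR]
        apply Finset.mem_insert_of_mem
        simp only [Finset.mem_biUnion, Finset.mem_image]
        exact ⟨u, by simp, R, reachR_mono _ _ (Finset.subset_insert _ _) hR, rfl⟩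
      · rw [Finset.disjoint_union_left]
        refine ⟨?_, hRI⟩
        rw [Finset.disjoint_left]
        intro y hy hyI
        simp only [Finset.mem_filter] at hy
        have := hmax y hyI
        omega
      · apply Finset.union_subset
        · intro y hy
          simp only [hsupp, Finset.mem_filter, Finset.mem_univ, true_and] at hy ⊢
          omega
        · intro y hy
          have := hRs hy
          simp only [hsupp, Finset.mem_filter, Finset.mem_univ, true_and] at this ⊢
          exact hdeg_link_le _ _ _ this
      · set H := Finset.univ.filter (fun y => hdeg G u < hdeg G y) with hH
        rw [hlink_card] at hcard
        have h1 : ∀ y, hdeg G y * (m + 1).factorial ≤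
            (if y ∈ H then n ^ (m + 1) else 0) + hdeg G u * (m + 1).factorial := by
          intro y
          split_ifs with hy
          · have := hdegle y
            omega
          · simp only [hH, Finset.mem_filter, Finset.mem_univ, true_and, not_lt] at hy
            have := Nat.mul_le_mul_right (m + 1).factorial hy
            omega
        have h2 : (∑ y, hdeg G y) * (m + 1).factorial ≤
            H.card * n ^ (m + 1) + n * (hdeg G u * (m + 1).factorial) := by
          rw [Finset.sum_mul]
          refine (Finset.sum_le_sum (fun y _ => h1 y)).trans ?_
          rw [Finset.sum_add_distrib]
          simp
        rw [hsum] at h2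
        have hHl : H.card ≤ (H ∪ R).card := Finset.card_le_card Finset.subset_union_left
        have hRl : R.card ≤ (H ∪ R).card := Finset.card_le_card Finset.subset_union_right
        have h3 : n * (hdeg G u * (m + 1).factorial) ≤ (m + 1) * ((H ∪ R).card * n ^ (m + 1)) := by
          rw [Nat.factorial_succ]
          calc n * (hdeg G u * ((m + 1) * m.factorial))
              = (m + 1) * (n * (hdeg G u * m.factorial)) := by ring
            _ ≤ (m + 1) * (n * (R.card * n ^ m)) := by gcongr
            _ ≤ (m + 1) * (n * ((H ∪ R).card * n ^ m)) := by gcongr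
            _ = _ := by ring
        have h4 : H.card * n ^ (m + 1) ≤ (H ∪ R).card * n ^ (m + 1) := Nat.mul_le_mul_right _ hHl
        have h5 : (m + 2) * (G.card * (m + 1).factorial) ≤
            (m + 2) * ((H ∪ R).card * n ^ (m + 1)) := by
          have : (m + 1 + 1) * G.card * (m + 1).factorial
            = (m + 2) * (G.card * (m + 1).factorial) := by ring
          rw [this] at h2
          linarith
        exact Nat.le_of_mul_le_mul_left h5 (by omega)

/-- Variable sets of the constraints falsified by `B`. -/
noncomputable def Efal {n q k : ℕ} (φ : CSP n q k) (B : Fin n → Fin k) :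
    Finset (Finset (Fin n)) :=
  (φ.constraints.filter (fun c => c.2 B = false)).image Prod.fst

lemma Efal_card {n q k : ℕ} (φ : CSP n q k) (B : Fin n → Fin k) :
    (Efal φ B).card = (φ.constraints.filter (fun c => c.2 B = false)).card := by
  unfold Efal
  apply Finset.card_image_of_injOn
  intro c hc c' hc' h
  simp only [Finset.coe_filter, Set.mem_ofPred_eq] at hc hc'
  exact φ.unique c hc.1 c' hc'.1 h

lemma Efal_unif {n q k : ℕ} (φ : CSP n q k) (B : Fin n → Fin k) :
    ∀ T ∈ Efal φ B, T.card = q := by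
  intro T hT
  simp only [Efal, Finset.mem_image, Finset.mem_filter] at hT
  obtain ⟨c, ⟨h, _⟩, rfl⟩ := hT
  exact φ.uniform c h

/-- Falsified sets through `x`, the value of `x` being `a`, the others following `B` inside `C`. -/
noncomputable def edg {n q k : ℕ} (φ : CSP n q k) (C : Fin n → Finset (Fin k)) (x : Fin n)
    (a : Fin k) (B : Fin n → Fin k) : Finset (Finset (Fin n)) :=
  (Efal φ (Function.update B x a)).filter (fun T => x ∈ T ∧ ∀ y ∈ T, y ≠ x → B y ∈ C y)

lemma bst_exists {n q k : ℕ} (φ : CSP n q k) (C : Fin n → Finset (Fin k)) (x : Fin n)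
    (a : Fin k) : ∃ B : Fin n → Fin k, ∀ B', (edg φ C x a B').card ≤ (edg φ C x a B).card := by
  have : Nonempty (Fin n → Fin k) := ⟨fun _ => a⟩
  exact Finite.exists_max (fun B => (edg φ C x a B).card)

/-- An optimal completion. -/
noncomputable def bst {n q k : ℕ} (φ : CSP n q k) (C : Fin n → Finset (Fin k)) (x : Fin n)
    (a : Fin k) : Fin n → Fin k := (bst_exists φ C x a).choose

/-- The degree of the pair `(x, a)` in the container `C`. -/
noncomputable def cdeg {n q k : ℕ} (φ : CSP n q k) (C : Fin n → Finset (Fin k)) (x : Fin n)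
    (a : Fin k) : ℕ := (edg φ C x a (bst φ C x a)).card

lemma le_cdeg {n q k : ℕ} (φ : CSP n q k) (C : Fin n → Finset (Fin k)) (x : Fin n)
    (a : Fin k) (B : Fin n → Fin k) : (edg φ C x a B).card ≤ cdeg φ C x a :=
  (bst_exists φ C x a).choose_spec B

lemma cdeg_mono {n q k : ℕ} (φ : CSP n q k) {C C' : Fin n → Finset (Fin k)}
    (h : ∀ y, C y ⊆ C' y) (x : Fin n) (a : Fin k) : cdeg φ C x a ≤ cdeg φ C' x a := by
  refine le_trans ?_ (le_cdeg φ C' x a (bst φ C x a))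
  apply Finset.card_le_card
  intro T hT
  simp only [edg, Finset.mem_filter] at hT ⊢
  exact ⟨hT.1, hT.2.1, fun y hy hyx => h y (hT.2.2 y hy hyx)⟩

/-- The link hypergraph used in a round. -/
noncomputable def lnk {n q k : ℕ} (φ : CSP n q k) (C : Fin n → Finset (Fin k)) (x : Fin n)
    (a : Fin k) : Finset (Finset (Fin n)) :=
  (edg φ C x a (bst φ C x a)).image (fun T => T.erase x)

lemma lnk_card {n q k : ℕ} (φ : CSP n q k) (C : Fin n → Finset (Fin k)) (x : Fin n)
    (a : Fin k) : (lnk φ C x a).card = cdeg φ C x a := by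
  unfold lnk cdeg
  apply Finset.card_image_of_injOn
  intro T hT T' hT' h
  simp only [edg, Finset.coe_filter, Set.mem_ofPred_eq] at hT hT'
  have h' : T.erase x = T'.erase x := h
  rw [← Finset.insert_erase hT.2.1, ← Finset.insert_erase hT'.2.1, h']

lemma lnk_unif {n q k : ℕ} (φ : CSP n q k) (C : Fin n → Finset (Fin k)) (x : Fin n)
    (a : Fin k) : ∀ T ∈ lnk φ C x a, T.card = q - 1 := by
  intro T hT
  simp only [lnk, edg, Finset.mem_image, Finset.mem_filter] at hT
  obtain ⟨T', ⟨h1, h2, _⟩, rfl⟩ := hT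
  rw [Finset.card_erase_of_mem h2, Efal_unif _ _ _ h1]

lemma cdeg_le {n q k : ℕ} (φ : CSP n q k) (C : Fin n → Finset (Fin k)) (x : Fin n)
    (a : Fin k) : cdeg φ C x a * (q - 1).factorial ≤ n ^ (q - 1) := by
  rw [← lnk_card]
  exact unif_card_le _ (lnk_unif φ C x a)

/-- One container step. -/
noncomputable def stepC {n q k : ℕ} (φ : CSP n q k) (C : Fin n → Finset (Fin k)) (x : Fin n)
    (a : Fin k) (R : Finset (Fin n)) : Fin n → Finset (Fin k) := fun y =>
  (C y).filter (fun b => cdeg φ C y b ≤ cdeg φ C x a ∧ ¬ (y ∈ R ∧ b = bst φ C x a y))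

/-- Containers reachable in one step with fingerprints in `Q`. -/
noncomputable def nextC {n q k : ℕ} (φ : CSP n q k) (Q : Finset (Fin n))
    (C : Fin n → Finset (Fin k)) : Finset (Fin n → Finset (Fin k)) :=
  Q.biUnion fun x => (Finset.univ : Finset (Fin k)).biUnion fun a =>
    (reachR (q - 2) (lnk φ C x a) Q).image (stepC φ C x a)

/-- Containers reachable in `r` steps with fingerprints in `Q`. -/
noncomputable def reach {n q k : ℕ} (φ : CSP n q k) (Q : Finset (Fin n)) :
    ℕ → Finset (Fin n → Finset (Fin k))
  | 0 => {fun _ => Finset.univ}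
  | r + 1 => (reach φ Q r).biUnion (nextC φ Q)

lemma nextC_mono {n q k : ℕ} (φ : CSP n q k) {Q Q' : Finset (Fin n)} (h : Q ⊆ Q')
    (C : Fin n → Finset (Fin k)) : nextC φ Q C ⊆ nextC φ Q' C := by
  intro D hD
  simp only [nextC, Finset.mem_biUnion, Finset.mem_image] at hD ⊢
  obtain ⟨x, hx, a, ha, R, hR, rfl⟩ := hD
  exact ⟨x, h hx, a, ha, R, reachR_mono _ _ h hR, rfl⟩

lemma reach_mono {n q k : ℕ} (φ : CSP n q k) {Q Q' : Finset (Fin n)} (h : Q ⊆ Q') (r : ℕ) :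
    reach φ Q r ⊆ reach φ Q' r := by
  induction r with
  | zero => simp [reach]
  | succ r ih =>
    intro D hD
    simp only [reach, Finset.mem_biUnion] at hD ⊢
    obtain ⟨C, hC, hD⟩ := hD
    exact ⟨C, ih hC, nextC_mono φ h C hD⟩

lemma reach_card {n q k : ℕ} (φ : CSP n q k) (hq : 2 ≤ q) (Q : Finset (Fin n)) (r : ℕ) :
    (reach φ Q r).card ≤ (k * (Q.card + 1) ^ (q - 1)) ^ r := by
  induction r with
  | zero => simp [reach]
  | succ r ih =>
    simp only [reach]
    have h1 : ∀ C ∈ reach φ Q r, (nextC φ Q C).card ≤ k * (Q.card + 1) ^ (q - 1) := by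
      intro C _
      unfold nextC
      have h2 : ∀ x ∈ Q, ((Finset.univ : Finset (Fin k)).biUnion fun a =>
        (reachR (q - 2) (lnk φ C x a) Q).image (stepC φ C x a)).card
          ≤ k * (Q.card + 1) ^ (q - 2) := by
        intro x _
        have := Finset.card_biUnion_le_card_mul (Finset.univ : Finset (Fin k))
          (fun a => (reachR (q - 2) (lnk φ C x a) Q).image (stepC φ C x a))
          ((Q.card + 1) ^ (q - 2))
          (fun a _ => Finset.card_image_le.trans (reachR_card _ _ _))
        simpa using this
      refine (Finset.card_biUnion_le_card_mul _ _ _ h2).trans ?_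
      have e : q - 1 = (q - 2) + 1 := by omega
      rw [e, pow_succ]
      calc Q.card * (k * (Q.card + 1) ^ (q - 2))
          ≤ (Q.card + 1) * (k * (Q.card + 1) ^ (q - 2)) := Nat.mul_le_mul_right _ (by omega)
        _ = _ := by ring
    refine (Finset.card_biUnion_le_card_mul _ _ _ h1).trans ?_
    rw [pow_succ]
    exact Nat.mul_le_mul_right _ ih

/-- Total size of a container. -/
noncomputable def csize {n k : ℕ} (C : Fin n → Finset (Fin k)) : ℕ := ∑ y, (C y).card

lemma step_main {n q k : ℕ} (φ : CSP n q k) (hq : 2 ≤ q) (S : Finset (Fin n)) (hS : S.Nonempty)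
    (A : Fin n → Fin k) (hA : ∀ c ∈ φ.constraints, c.1 ⊆ S → c.2 A = true)
    (C : Fin n → Finset (Fin k)) (hC : ∀ x ∈ S, A x ∈ C x) :
    ∃ C' : Fin n → Finset (Fin k), ∃ D : ℕ, ∃ Q ⊆ S, Q.card ≤ q - 1 ∧ C' ∈ nextC φ Q C ∧
      (∀ x ∈ S, A x ∈ C' x) ∧ (∀ y, C' y ⊆ C y) ∧
      (∀ y, ∀ b ∈ C' y, cdeg φ C y b ≤ D) ∧ (∃ x ∈ S, D = cdeg φ C x (A x)) ∧
      D * (q - 2).factorial + csize C' * n ^ (q - 2) ≤ csize C * n ^ (q - 2) := by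
  obtain ⟨x, hx, hmax⟩ := Finset.exists_max_image S (fun x => cdeg φ C x (A x)) hS
  set B := bst φ C x (A x) with hB
  have hun : ∀ T ∈ lnk φ C x (A x), T.card = (q - 2) + 1 := by
    intro T hT
    rw [lnk_unif φ C x (A x) T hT]; omega
  obtain ⟨Q, hQ, hQc, R, hR, hRI, hRs, hcard⟩ := reachR_main (q - 2) (lnk φ C x (A x)) hun
    (S.filter (fun y => A y = B y)) (by
      intro T hT hTI
      simp only [lnk, edg, Efal, Finset.mem_image, Finset.mem_filter] at hT
      obtain ⟨T', ⟨⟨c, ⟨hc, hcf⟩, rfl⟩, hx', _⟩, rfl⟩ := hT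
      have hsub : c.1 ⊆ S := by
        rw [← Finset.insert_erase hx']
        exact Finset.insert_subset hx (hTI.trans (Finset.filter_subset _ _))
      have h1 := hA c hc hsub
      have h2 : c.2 A = c.2 (Function.update (bst φ C x (A x)) x (A x)) := by
        apply φ.localPred c hc
        intro y hy
        by_cases hyx : y = x
        · subst hyx; simp
        · rw [Function.update_of_ne hyx]
          have := hTI (Finset.mem_erase.mpr ⟨hyx, hy⟩)
          exact (Finset.mem_filter.mp this).2
      rw [h2, hcf] at h1
      exact absurd h1 (by simp))
  refine ⟨stepC φ C x (A x) R, cdeg φ C x (A x), insert x Q,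
    Finset.insert_subset hx (hQ.trans (Finset.filter_subset _ _)),
    (Finset.card_insert_le _ _).trans (by omega), ?_, ?_, ?_, ?_, ⟨x, hx, rfl⟩, ?_⟩
  · simp only [nextC, Finset.mem_biUnion, Finset.mem_image]
    exact ⟨x, by simp, A x, by simp, R, reachR_mono _ _ (Finset.subset_insert _ _) hR, rfl⟩
  · intro y hy
    simp only [stepC, Finset.mem_filter]
    refine ⟨hC y hy, hmax y hy, ?_⟩
    rintro ⟨h1, h2⟩
    exact Finset.disjoint_left.mp hRI h1 (Finset.mem_filter.mpr ⟨hy, h2⟩)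
  · intro y
    exact Finset.filter_subset _ _
  · intro y b hb
    simp only [stepC, Finset.mem_filter] at hb
    exact hb.2.1
  · rw [lnk_card] at hcard
    have hmem : ∀ y ∈ R, B y ∈ C y := by
      intro y hy
      have := hRs hy
      simp only [hsupp, hdeg, Finset.mem_filter, Finset.card_pos] at this
      obtain ⟨T, hT⟩ := this.2
      simp only [lnk, edg, Finset.mem_filter, Finset.mem_image] at hT
      obtain ⟨⟨T', ⟨_, _, h3⟩, rfl⟩, h4⟩ := hT
      have h5 := Finset.mem_erase.mp h4
      exact h3 y h5.2 h5.1
    have h1 : ∀ y, (stepC φ C x (A x) R y).card + (if y ∈ R then 1 else 0) ≤ (C y).card := by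
      intro y
      split_ifs with hy
      · apply Nat.succ_le_of_lt
        apply Finset.card_lt_card
        refine (Finset.ssubset_iff_of_subset (Finset.filter_subset _ _)).mpr ⟨B y, hmem y hy, ?_⟩
        simp [hy, hB]
      · exact Finset.card_le_card (Finset.filter_subset _ _)
    have h2 : csize (stepC φ C x (A x) R) + R.card ≤ csize C := by
      unfold csize
      refine le_trans (le_of_eq ?_) (Finset.sum_le_sum (fun y _ => h1 y))
      rw [Finset.sum_add_distrib]
      simp
    calc _ ≤ R.card * n ^ (q - 2) + csize (stepC φ C x (A x) R) * n ^ (q - 2) := by omega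
      _ = (csize (stepC φ C x (A x) R) + R.card) * n ^ (q - 2) := by ring
      _ ≤ _ := Nat.mul_le_mul_right _ h2

lemma seq_exists {n q k : ℕ} (φ : CSP n q k) (hq : 2 ≤ q) (S : Finset (Fin n)) (hS : S.Nonempty)
    (A : Fin n → Fin k) (hA : ∀ c ∈ φ.constraints, c.1 ⊆ S → c.2 A = true) :
    ∃ (C : ℕ → Fin n → Finset (Fin k)) (D : ℕ → ℕ) (Q : ℕ → Finset (Fin n)),
      C 0 = (fun _ => Finset.univ) ∧ (∀ r, Q r ⊆ S) ∧ (∀ r, (Q r).card ≤ r * (q - 1)) ∧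
      (∀ r, C r ∈ reach φ (Q r) r) ∧ (∀ r, ∀ x ∈ S, A x ∈ C r x) ∧
      (∀ r y, C (r + 1) y ⊆ C r y) ∧ (∀ r y, ∀ b ∈ C (r + 1) y, cdeg φ (C r) y b ≤ D r) ∧
      (∀ r, ∃ x ∈ S, D r = cdeg φ (C r) x (A x)) ∧
      (∀ r, D r * (q - 2).factorial + csize (C (r + 1)) * n ^ (q - 2)
        ≤ csize (C r) * n ^ (q - 2)) := by
  choose nx D Qs h1 h2 h3 h4 h5 h6 h7 h8 using
    (fun (C : Fin n → Finset (Fin k)) (hC : ∀ x ∈ S, A x ∈ C x) =>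
      step_main φ hq S hS A hA C hC)
  let f : ℕ → {C : Fin n → Finset (Fin k) // ∀ x ∈ S, A x ∈ C x} := fun r =>
    Nat.rec ⟨fun _ => Finset.univ, fun _ _ => Finset.mem_univ _⟩
      (fun _ C => ⟨nx C.1 C.2, h4 C.1 C.2⟩) r
  have hf : ∀ r, (f (r + 1)).1 = nx (f r).1 (f r).2 := fun r => rfl
  let Q : ℕ → Finset (Fin n) := fun r =>
    Nat.rec ∅ (fun r Q => Q ∪ Qs (f r).1 (f r).2) r
  have hQ : ∀ r, Q (r + 1) = Q r ∪ Qs (f r).1 (f r).2 := fun r => rfl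
  have hQ0 : Q 0 = ∅ := rfl
  refine ⟨fun r => (f r).1, fun r => D (f r).1 (f r).2, Q, rfl, ?_, ?_, ?_,
    fun r => (f r).2, ?_, ?_, ?_, ?_⟩
  · intro r
    induction r with
    | zero => simp [hQ0]
    | succ r ih => rw [hQ]; exact Finset.union_subset ih (h1 _ _)
  · intro r
    induction r with
    | zero => simp [hQ0]
    | succ r ih =>
      rw [hQ]
      refine (Finset.card_union_le _ _).trans ?_
      have := h2 (f r).1 (f r).2
      rw [Nat.succ_mul]
      omega
  · intro r
    induction r with
    | zero => simp [reach, f]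
    | succ r ih =>
      simp only [reach, Finset.mem_biUnion]
      refine ⟨(f r).1, reach_mono φ (by rw [hQ]; exact Finset.subset_union_left) r ih, ?_⟩
      exact nextC_mono φ (by rw [hQ]; exact Finset.subset_union_right) _ (h3 (f r).1 (f r).2)
  · intro r y
    exact h5 _ _ y
  · intro r y b hb
    exact h6 _ _ y b hb
  · intro r
    exact h7 _ _
  · intro r
    exact h8 _ _

lemma abel_aux {n R : ℕ} (D : ℕ → ℝ) (hD : ∀ i, D (i + 1) ≤ D i) (hD0 : ∀ i, 0 ≤ D i)
    (rr : Fin n → ℕ) (hrr : ∀ x, rr x ≤ R) (η : ℝ)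
    (hm : ∀ i < R, ((Finset.univ.filter (fun x => rr x ≤ i)).card : ℝ) ≤ (i + 1) * η) (hη : 0 ≤ η) :
    ∑ x, D (rr x) ≤ n * D R + η * ∑ i ∈ Finset.range R, D i := by
  have key : ∀ N ρ : ℕ, ρ ≤ N →
      D ρ = D N + ∑ i ∈ Finset.range N, if ρ ≤ i then D i - D (i + 1) else 0 := by
    intro N
    induction N with
    | zero => intro ρ h; have : ρ = 0 := by omega
              subst this; simp
    | succ N ih =>
      intro ρ h
      rw [Finset.sum_range_succ]
      rcases Nat.lt_or_ge N ρ with h' | h'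
      · have : ρ = N + 1 := by omega
        subst this
        rw [Finset.sum_eq_zero]
        · simp
        · intro i hi
          have := Finset.mem_range.mp hi
          rw [if_neg (by omega)]
      · rw [if_pos h', ih ρ h']
        ring
  have e1 : ∑ x, D (rr x) = n * D R + ∑ i ∈ Finset.range R,
      ((Finset.univ.filter (fun x => rr x ≤ i)).card : ℝ) * (D i - D (i + 1)) := by
    rw [Finset.sum_congr rfl (fun x _ => key R (rr x) (hrr x)), Finset.sum_add_distrib,
      Finset.sum_comm]
    congr 1
    · simp
    · apply Finset.sum_congr rfl
      intro i _
      rw [← Finset.sum_filter, Finset.sum_const, nsmul_eq_mul]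
  have e2 : ∑ i ∈ Finset.range R,
      ((Finset.univ.filter (fun x => rr x ≤ i)).card : ℝ) * (D i - D (i + 1))
      ≤ ∑ i ∈ Finset.range R, ((i + 1) * η) * (D i - D (i + 1)) := by
    apply Finset.sum_le_sum
    intro i hi
    apply mul_le_mul_of_nonneg_right (hm i (Finset.mem_range.mp hi))
    linarith [hD i]
  have e3 : ∀ N : ℕ, ∑ i ∈ Finset.range N, (((i : ℝ) + 1) * η) * (D i - D (i + 1))
      = η * ∑ i ∈ Finset.range N, D i - N * η * D N := by
    intro N
    induction N with
    | zero => simp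
    | succ N ih =>
      rw [Finset.sum_range_succ, ih, Finset.sum_range_succ]
      push_cast
      ring
  rw [e1]
  have := e3 R
  have h0 : 0 ≤ (R : ℝ) * η * D R := by have := hD0 R; positivity
  linarith

lemma det_main {n q k : ℕ} (φ : CSP n q k) (hq : 2 ≤ q) (S : Finset (Fin n)) (hS : S.Nonempty)
    (hsat : φ.SatOn S) (ε η : ℝ) (hη : 0 ≤ η) (hfar : φ.EpsFar ε) (R : ℕ) (hR : 1 ≤ R)
    (hlt : (n : ℝ) ^ q / (q - 2).factorial * (k / R + η * (k + 1)) < ε * n.choose q) :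
    ∃ r, 1 ≤ r ∧ r ≤ R ∧ ∃ Q ⊆ S, Q.card ≤ r * (q - 1) ∧ ∃ C ∈ reach φ Q r,
      Disjoint S (Finset.univ.filter (fun x => C x = ∅)) ∧
      (r : ℝ) * η * n ≤ ((Finset.univ.filter (fun x => C x = ∅)).card : ℝ) := by
  obtain ⟨A, hA⟩ := hsat
  obtain ⟨C, D, Q, hC0, hQS, hQc, hCr, hAC, hCm, hCD, hDx, hDs⟩ := seq_exists φ hq S hS A hA
  by_contra hcon
  push Not at hcon
  have hm : ∀ r, 1 ≤ r → r ≤ R →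
      ((Finset.univ.filter (fun x => C r x = ∅)).card : ℝ) < r * η * n := by
    intro r h1 h2
    refine hcon r h1 h2 (Q r) (hQS r) (hQc r) (C r) (hCr r) ?_
    rw [Finset.disjoint_left]
    intro x hx hx'
    have := hAC r x hx
    rw [(Finset.mem_filter.mp hx').2] at this
    simp at this
  have hCanti : ∀ i j, i ≤ j → ∀ y, C j y ⊆ C i y := by
    intro i j hij y
    induction j, hij using Nat.le_induction with
    | base => exact subset_rfl
    | succ j _ ih => exact (hCm j y).trans ih
  -- the last round at which `x` has a nonempty list
  let rr : Fin n → ℕ := fun x => Nat.findGreatest (fun r => (C r x).Nonempty) R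
  have hne0 : ∀ x, (C 0 x).Nonempty := by
    intro x
    rw [hC0]
    exact ⟨A x, Finset.mem_univ _⟩
  have hrrne : ∀ x, (C (rr x) x).Nonempty := fun x =>
    Nat.findGreatest_spec (P := fun r => (C r x).Nonempty) (Nat.zero_le R) (hne0 x)
  have hrrle : ∀ x, rr x ≤ R := fun x => Nat.findGreatest_le R
  have hrrgt : ∀ x r, rr x < r → r ≤ R → C r x = ∅ := by
    intro x r h1 h2
    have := Nat.findGreatest_is_greatest (P := fun r => (C r x).Nonempty) h1 h2
    exact Finset.not_nonempty_iff_eq_empty.mp this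
  choose As hAs using hrrne
  set P : ℝ := (n : ℝ) ^ (q - 1) / (q - 2).factorial with hP
  have hPn : 0 ≤ P := by positivity
  have hfpos : (0 : ℝ) < (q - 2).factorial := by exact_mod_cast Nat.factorial_pos _
  have hcdegP : ∀ C' x a, (cdeg φ C' x a : ℝ) ≤ P := by
    intro C' x a
    rw [hP, le_div_iff₀ hfpos]
    have h1 := cdeg_le φ C' x a
    have h2 : (q - 2).factorial ≤ (q - 1).factorial := Nat.factorial_le (by omega)
    have h3 : cdeg φ C' x a * (q - 2).factorial ≤ n ^ (q - 1) :=
      (Nat.mul_le_mul_left _ h2).trans h1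
    exact_mod_cast h3
  let D' : ℕ → ℝ := fun i => Nat.rec P (fun j _ => (D j : ℝ)) i
  have hD'0 : D' 0 = P := rfl
  have hD's : ∀ j, D' (j + 1) = (D j : ℝ) := fun j => rfl
  have hD'anti : ∀ i, D' (i + 1) ≤ D' i := by
    intro i
    rw [hD's]
    obtain ⟨x, hx, hDi⟩ := hDx i
    rw [hDi]
    cases i with
    | zero => exact hcdegP _ _ _
    | succ j =>
      rw [hD's]
      exact_mod_cast (cdeg_mono φ (hCm j) x (A x)).trans (hCD j x (A x) (hAC (j + 1) x hx))
  have hD'nn : ∀ i, 0 ≤ D' i := by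
    intro i
    cases i with
    | zero => exact hPn
    | succ j => rw [hD's]; positivity
  have hdegbound : ∀ x, (cdeg φ (C (rr x)) x (As x) : ℝ) ≤ D' (rr x) := by
    intro x
    have h := hAs x
    generalize rr x = r at h ⊢
    cases r with
    | zero => exact hcdegP _ _ _
    | succ j =>
      rw [hD's]
      exact_mod_cast (cdeg_mono φ (hCm j) x (As x)).trans (hCD j x (As x) h)
  have hcover : Efal φ As ⊆ Finset.univ.biUnion (fun x => edg φ (C (rr x)) x (As x) As) := by
    intro T hT
    have hTne : T.Nonempty := by
      rw [← Finset.card_pos, Efal_unif φ As T hT]; omega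
    obtain ⟨x, hx, hmin⟩ := Finset.exists_min_image T rr hTne
    simp only [Finset.mem_biUnion, Finset.mem_univ, true_and]
    refine ⟨x, ?_⟩
    simp only [edg, Finset.mem_filter, Function.update_eq_self]
    exact ⟨hT, hx, fun y hy _ => hCanti _ _ (hmin y hy) y (hAs y)⟩
  have hcount : ε * n.choose q ≤ ∑ x, D' (rr x) := by
    refine (hfar As).trans ?_
    rw [← Efal_card]
    have h1 : (Efal φ As).card ≤ ∑ x, cdeg φ (C (rr x)) x (As x) :=
      (Finset.card_le_card hcover).trans (Finset.card_biUnion_le.trans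
        (Finset.sum_le_sum (fun x _ => le_cdeg φ _ _ _ _)))
    calc ((Efal φ As).card : ℝ) ≤ ((∑ x, cdeg φ (C (rr x)) x (As x) : ℕ) : ℝ) := by
          exact_mod_cast h1
      _ = ∑ x, (cdeg φ (C (rr x)) x (As x) : ℝ) := by push_cast; rfl
      _ ≤ _ := Finset.sum_le_sum (fun x _ => hdegbound x)
  have habel := abel_aux (R := R) D' hD'anti hD'nn rr hrrle (η * n) (by
    intro i hi
    have h1 : (Finset.univ.filter (fun x => rr x ≤ i)).card ≤
        (Finset.univ.filter (fun x => C (i + 1) x = ∅)).card := by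
      apply Finset.card_le_card
      intro x hx
      simp only [Finset.mem_filter, Finset.mem_univ, true_and] at hx ⊢
      exact hrrgt x (i + 1) (by omega) (by omega)
    have h2 := hm (i + 1) (by omega) (by omega)
    have h3 : ((Finset.univ.filter (fun x => rr x ≤ i)).card : ℝ) ≤
      ((Finset.univ.filter (fun x => C (i + 1) x = ∅)).card : ℝ) := by exact_mod_cast h1
    push_cast at h2
    linarith) (by positivity)
  -- total degree sum
  have hsumN : ∀ N : ℕ, (∑ i ∈ Finset.range N, D i) * (q - 2).factorial
      + csize (C N) * n ^ (q - 2) ≤ csize (C 0) * n ^ (q - 2) := by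
    intro N
    induction N with
    | zero => simp
    | succ N ih =>
      rw [Finset.sum_range_succ, add_mul]
      have := hDs N
      omega
  have hc0 : csize (C 0) * n ^ (q - 2) = k * n ^ (q - 1) := by
    rw [hC0]
    have e : q - 1 = q - 2 + 1 := by omega
    rw [e]
    simp [csize]
    ring
  have hsum : ∑ i ∈ Finset.range R, (D i : ℝ) ≤ k * P := by
    have h1 := hsumN R
    rw [hc0] at h1
    have h2 : (∑ i ∈ Finset.range R, D i) * (q - 2).factorial ≤ k * n ^ (q - 1) := by omega
    rw [hP, mul_div_assoc', le_div_iff₀ hfpos]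
    exact_mod_cast h2
  have hsum2 : ∑ i ∈ Finset.range R, D' i ≤ (k + 1) * P := by
    have h1 : ∑ i ∈ Finset.range R, D' i ≤ ∑ i ∈ Finset.range (R + 1), D' i := by
      rw [Finset.sum_range_succ]; linarith [hD'nn R]
    rw [Finset.sum_range_succ', hD'0] at h1
    simp only [hD's] at h1
    linarith
  have hRpos : (0 : ℝ) < R := by exact_mod_cast hR
  have hlast : D' R ≤ k * P / R := by
    rw [le_div_iff₀ hRpos]
    refine le_trans ?_ hsum
    have hanti : Antitone D' := antitone_nat_of_succ_le hD'anti
    have h1 : ∑ i ∈ Finset.range R, D' R ≤ ∑ i ∈ Finset.range R, (D i : ℝ) := by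
      apply Finset.sum_le_sum
      intro i hi
      have hi' : i + 1 ≤ R := Finset.mem_range.mp hi
      rw [← hD's i]
      exact hanti hi'
    simp only [Finset.sum_const, Finset.card_range, nsmul_eq_mul] at h1
    linarith
  have hnP : (n : ℝ) ^ q / (q - 2).factorial = n * P := by
    have e : (n : ℝ) ^ q = n * (n : ℝ) ^ (q - 1) := by
      rw [← pow_succ']
      congr 1
      omega
    rw [hP, e]
    ring
  rw [hnP] at hlt
  have f1 : (n : ℝ) * D' R ≤ n * (k * P / R) := by gcongr
  have f2 : η * n * ∑ i ∈ Finset.range R, D' i ≤ η * n * ((k + 1) * P) := by gcongr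
  have f3 : (n : ℝ) * P * (k / R + η * (k + 1)) = n * (k * P / R) + η * n * ((k + 1) * P) := by
    ring
  linarith

lemma choose_exp (n N e : ℕ) (hN : N ≤ n) (hn : 0 < n) (j : ℕ) :
    ((N - e).choose j : ℝ) ≤ Real.exp (-((e : ℝ) / n)) ^ j * N.choose j := by
  induction j with
  | zero => simp
  | succ j ih =>
    rcases Nat.lt_or_ge j (N - e) with h | h
    · have h1 : ((N - e).choose (j + 1) : ℝ) * (j + 1) = (N - e).choose j * ((N : ℝ) - e - j) := by
        have := Nat.choose_succ_right_eq (N - e) j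
        have h2 : ((N - e - j : ℕ) : ℝ) = (N : ℝ) - e - j := by
          rw [Nat.cast_sub (by omega), Nat.cast_sub (by omega)]
        rw [← h2]
        exact_mod_cast this
      have h3 : (N.choose (j + 1) : ℝ) * (j + 1) = N.choose j * ((N : ℝ) - j) := by
        have := Nat.choose_succ_right_eq N j
        have h2 : ((N - j : ℕ) : ℝ) = (N : ℝ) - j := by
          rw [Nat.cast_sub (by omega)]
        rw [← h2]
        exact_mod_cast this
      have hn' : (0 : ℝ) < n := by exact_mod_cast hn
      have hNn : (N : ℝ) ≤ n := by exact_mod_cast hN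
      have hjN : (0 : ℝ) ≤ (N : ℝ) - j := by
        have : (j : ℝ) ≤ N := by exact_mod_cast (by omega : j ≤ N)
        linarith
      have h4 : (N : ℝ) - e - j ≤ Real.exp (-((e : ℝ) / n)) * ((N : ℝ) - j) := by
        have h5 : 1 - (e : ℝ) / n ≤ Real.exp (-((e : ℝ) / n)) := by
          have := Real.add_one_le_exp (-((e : ℝ) / n)); linarith
        have h6 : (e : ℝ) / n * (N - j) ≤ e := by
          rw [div_mul_eq_mul_div, div_le_iff₀ hn']
          apply mul_le_mul_of_nonneg_left _ (by positivity)
          have : (0 : ℝ) ≤ j := by positivity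
          linarith
        have h7 := mul_le_mul_of_nonneg_right h5 hjN
        linarith
      have hj1 : (0 : ℝ) < (j : ℝ) + 1 := by positivity
      apply le_of_mul_le_mul_right _ hj1
      rw [h1, mul_assoc, h3, pow_succ]
      calc ((N - e).choose j : ℝ) * ((N : ℝ) - e - j)
          ≤ (N - e).choose j * (Real.exp (-((e : ℝ) / n)) * ((N : ℝ) - j)) := by gcongr
        _ ≤ (Real.exp (-((e : ℝ) / n)) ^ j * N.choose j)
            * (Real.exp (-((e : ℝ) / n)) * ((N : ℝ) - j)) := by gcongr
        _ = _ := by ring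
    · rw [Nat.choose_eq_zero_of_lt (by omega)]
      simp only [Nat.cast_zero]
      positivity

lemma count_one {n s : ℕ} (hn : 0 < n) (Q E : Finset (Fin n)) (hQs : Q.card ≤ s)
    (m : ℝ) (hm : m ≤ E.card) :
    ((((Finset.univ : Finset (Fin n)).powersetCard s).filter
      (fun S => Q ⊆ S ∧ Disjoint S E)).card : ℝ) ≤
      Real.exp (-(m / n)) ^ (s - Q.card) * (n - Q.card).choose (s - Q.card) := by
  have hn' : (0 : ℝ) < n := by exact_mod_cast hn
  by_cases hQE : Disjoint Q E
  · have h1 : (((Finset.univ : Finset (Fin n)).powersetCard s).filter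
      (fun S => Q ⊆ S ∧ Disjoint S E)).card ≤
        (((Finset.univ : Finset (Fin n)) \ (Q ∪ E)).powersetCard (s - Q.card)).card := by
      apply Finset.card_le_card_of_injOn (fun S => S \ Q)
      · intro S hS
        simp only [Finset.coe_filter, Finset.mem_powersetCard, Set.mem_ofPred_eq] at hS
        obtain ⟨⟨_, h2⟩, h3, h4⟩ := hS
        simp only [Finset.mem_coe, Finset.mem_powersetCard]
        constructor
        · intro y hy
          simp only [Finset.mem_sdiff, Finset.mem_union, Finset.mem_univ, true_and, not_or] at hy ⊢
          exact ⟨hy.2, Finset.disjoint_left.mp h4 hy.1⟩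
        · rw [Finset.card_sdiff_of_subset h3, h2]
      · intro S hS S' hS' h
        simp only [Finset.coe_filter, Set.mem_ofPred_eq] at hS hS'
        have h' : S \ Q = S' \ Q := h
        rw [← Finset.sdiff_union_of_subset hS.2.1, ← Finset.sdiff_union_of_subset hS'.2.1, h']
    have h2 : ((Finset.univ : Finset (Fin n)) \ (Q ∪ E)).card = n - Q.card - E.card := by
      rw [Finset.card_sdiff_of_subset (Finset.subset_univ _), Finset.card_union_of_disjoint hQE]
      simp only [Finset.card_univ, Fintype.card_fin]
      omega
    rw [Finset.card_powersetCard, h2] at h1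
    have h3 := choose_exp n (n - Q.card) E.card (by omega) hn (s - Q.card)
    have h4 : Real.exp (-((E.card : ℝ) / n)) ≤ Real.exp (-(m / n)) := by
      apply Real.exp_le_exp.mpr
      have : m / n ≤ (E.card : ℝ) / n := by gcongr
      linarith
    calc _ ≤ ((n - Q.card - E.card).choose (s - Q.card) : ℝ) := by exact_mod_cast h1
      _ ≤ _ := h3
      _ ≤ _ := by gcongr
  · rw [Finset.card_eq_zero.mpr]
    · simp only [Nat.cast_zero]
      positivity
    · rw [Finset.filter_eq_empty_iff]
      rintro S _ ⟨h1, h2⟩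
      exact hQE (Finset.disjoint_of_subset_left h1 h2)

lemma count_round {n q k : ℕ} (φ : CSP n q k) (hn : 0 < n) (hq : 2 ≤ q) (s r t : ℕ) (hts : t ≤ s)
    (m : ℝ) :
    ((((Finset.univ : Finset (Fin n)).powersetCard s).filter
      (fun S => ∃ Q ⊆ S, Q.card ≤ t ∧ ∃ C ∈ reach φ Q r,
      Disjoint S (Finset.univ.filter (fun x => C x = ∅)) ∧
      m ≤ ((Finset.univ.filter (fun x => C x = ∅)).card : ℝ))).card : ℝ) ≤
      n.choose s * (s.choose t * (k * (t + 1) ^ (q - 1)) ^ r * Real.exp (-(m / n)) ^ (s - t)) := by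
  set bad := ((Finset.univ : Finset (Fin n)).powersetCard s).filter
      (fun S => ∃ Q ⊆ S, Q.card ≤ t ∧ ∃ C ∈ reach φ Q r,
      Disjoint S (Finset.univ.filter (fun x => C x = ∅)) ∧
      m ≤ ((Finset.univ.filter (fun x => C x = ∅)).card : ℝ)) with hbad
  let cov : Finset (Fin n) → Finset (Finset (Fin n)) := fun Q =>
    ((reach φ Q r).filter
      (fun C => m ≤ ((Finset.univ.filter (fun x => C x = ∅)).card : ℝ))).biUnion fun C =>
    ((Finset.univ : Finset (Fin n)).powersetCard s).filter
      (fun S => Q ⊆ S ∧ Disjoint S (Finset.univ.filter (fun x => C x = ∅)))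
  have hsub : bad ⊆ ((Finset.univ : Finset (Fin n)).powersetCard t).biUnion cov := by
    intro S hS
    rw [hbad, Finset.mem_filter] at hS
    obtain ⟨hS1, Q, hQS, hQc, C, hC, hdis, hmE⟩ := hS
    have hSc := (Finset.mem_powersetCard.mp hS1).2
    obtain ⟨Q', hQQ', hQ'S, hQ'c⟩ := Finset.exists_subsuperset_card_eq hQS hQc (hSc ▸ hts)
    simp only [Finset.mem_biUnion, cov]
    refine ⟨Q', by simp [Finset.mem_powersetCard, hQ'c], C, ?_, ?_⟩
    · exact Finset.mem_filter.mpr ⟨reach_mono φ hQQ' r hC, hmE⟩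
    · exact Finset.mem_filter.mpr ⟨hS1, hQ'S, hdis⟩
  have hcov : ∀ Q ∈ (Finset.univ : Finset (Fin n)).powersetCard t, ((cov Q).card : ℝ) ≤
      (k * (t + 1) ^ (q - 1)) ^ r * (Real.exp (-(m / n)) ^ (s - t) * (n - t).choose (s - t)) := by
    intro Q hQ
    have hQc := (Finset.mem_powersetCard.mp hQ).2
    have h1 : ((cov Q).card : ℝ) ≤ ∑ C ∈ ((reach φ Q r).filter
      (fun C => m ≤ ((Finset.univ.filter (fun x => C x = ∅)).card : ℝ))),
        ((((Finset.univ : Finset (Fin n)).powersetCard s).filter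
      (fun S => Q ⊆ S ∧ Disjoint S (Finset.univ.filter (fun x => C x = ∅)))).card : ℝ) := by
      exact_mod_cast Finset.card_biUnion_le
    refine h1.trans ?_
    have h2 := Finset.sum_le_card_nsmul ((reach φ Q r).filter
      (fun C => m ≤ ((Finset.univ.filter (fun x => C x = ∅)).card : ℝ)))
      (fun C => ((((Finset.univ : Finset (Fin n)).powersetCard s).filter
      (fun S => Q ⊆ S ∧ Disjoint S (Finset.univ.filter (fun x => C x = ∅)))).card : ℝ))
      (Real.exp (-(m / n)) ^ (s - t) * (n - t).choose (s - t)) (by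
        intro C hC
        have := count_one (s := s) hn Q (Finset.univ.filter (fun x => C x = ∅)) (by omega) m
          (Finset.mem_filter.mp hC).2
        rw [hQc] at this
        exact this)
    refine h2.trans ?_
    rw [nsmul_eq_mul]
    apply mul_le_mul_of_nonneg_right _ (by positivity)
    have h3 : ((reach φ Q r).filter
      (fun C => m ≤ ((Finset.univ.filter (fun x => C x = ∅)).card : ℝ))).card
        ≤ (k * (t + 1) ^ (q - 1)) ^ r := by
      refine (Finset.card_filter_le _ _).trans ?_
      have := reach_card φ hq Q r
      rwa [hQc] at this
    exact_mod_cast h3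
  have h1 : (bad.card : ℝ) ≤ ∑ Q ∈ (Finset.univ : Finset (Fin n)).powersetCard t,
      ((cov Q).card : ℝ) := by
    exact_mod_cast (Finset.card_le_card hsub).trans Finset.card_biUnion_le
  refine h1.trans ((Finset.sum_le_card_nsmul _ _ _ hcov).trans (le_of_eq ?_))
  have h2 : (n.choose s : ℝ) * s.choose t = n.choose t * (n - t).choose (s - t) := by
    exact_mod_cast Nat.choose_mul hts
  rw [nsmul_eq_mul, Finset.card_powersetCard, Finset.card_univ, Fintype.card_fin]
  linear_combination (-(((k : ℝ) * (t + 1) ^ (q - 1)) ^ r * Real.exp (-(m / n)) ^ (s - t))) * h2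

lemma choose_lower {n q : ℕ} (hq : 2 ≤ q) (hn : 2 * q ^ 2 ≤ n) :
    (n : ℝ) ^ q ≤ 2 * (q.factorial * n.choose q : ℝ) := by
  have h1 := Nat.pow_sub_le_descFactorial n q
  rw [Nat.descFactorial_eq_factorial_mul_choose] at h1
  have hqn : q ≤ n := by nlinarith
  have hn0 : (0 : ℝ) < n := by exact_mod_cast (by omega : 0 < n)
  have h2 : (((n : ℝ) - q) ^ q : ℝ) ≤ (q.factorial * n.choose q : ℝ) := by
    have h3 : (n - q) ^ q ≤ q.factorial * n.choose q :=
      (Nat.pow_le_pow_left (by omega) q).trans h1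
    rw [← Nat.cast_sub hqn]
    exact_mod_cast h3
  have hqn' : (2 : ℝ) * q ^ 2 ≤ n := by exact_mod_cast hn
  have hqn2 : (q : ℝ) ≤ n := by exact_mod_cast hqn
  have h4 : 1 + (q : ℝ) * (-(q / n)) ≤ (1 + -((q : ℝ) / n)) ^ q := by
    apply one_add_mul_le_pow
    have : (q : ℝ) / n ≤ 1 := by rw [div_le_one hn0]; exact hqn2
    linarith
  have h5 : (1 : ℝ) / 2 ≤ 1 + (q : ℝ) * (-(q / n)) := by
    have : (q : ℝ) * (q / n) ≤ 1 / 2 := by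
      rw [← mul_div_assoc, div_le_div_iff₀ hn0 (by norm_num)]
      nlinarith
    linarith
  have h6 : ((n : ℝ) - q) ^ q = n ^ q * (1 + -((q : ℝ) / n)) ^ q := by
    rw [← mul_pow]
    congr 1
    field_simp
    ring
  have h7 : (n : ℝ) ^ q * (1 / 2) ≤ n ^ q * (1 + -((q : ℝ) / n)) ^ q := by
    gcongr
    linarith
  linarith

lemma base_small (q k : ℕ) (ε s : ℝ) (hq : 2 ≤ q) (hk : 2 ≤ k) (hε : 0 < ε)
    (hε8 : ε < Real.exp (-8)) (hs0 : 0 ≤ s)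
    (hs1 : 1000 * ((k : ℝ) * (q : ℝ) ^ 3 / ε) * (Real.log ((k : ℝ) * (q : ℝ) / ε)) ^ 2 ≤ s)
    (hs2 : s ≤ 1000 * ((k : ℝ) * (q : ℝ) ^ 3 / ε) * (Real.log ((k : ℝ) * (q : ℝ) / ε)) ^ 2 + 1) :
    64000 * ((k : ℝ) * (q : ℝ) ^ 3 / ε) ≤ s ∧
    s ^ (q - 1) * (k * s ^ (q - 1)) * Real.exp (-(ε / (32 * k * q ^ 2) * (s / 2))) ≤ 1 / 4 := by
  have hq' : (2 : ℝ) ≤ q := by exact_mod_cast hq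
  have hk' : (2 : ℝ) ≤ k := by exact_mod_cast hk
  set X : ℝ := (k : ℝ) * q / ε with hX
  set Y : ℝ := (k : ℝ) * (q : ℝ) ^ 3 / ε with hY
  set L := Real.log X with hL
  have he8 : (1001 : ℝ) ≤ Real.exp 8 := by
    have h1 := Real.exp_one_gt_d9
    have h2 : Real.exp 8 = Real.exp 1 ^ 8 := by rw [← Real.exp_nat_mul]; norm_num
    rw [h2]
    calc (1001 : ℝ) ≤ 2.7 ^ 8 := by norm_num
      _ ≤ _ := by gcongr; linarith
  have heps : Real.exp 8 ≤ 1 / ε := by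
    rw [le_div_iff₀ hε]
    have : Real.exp 8 * Real.exp (-8) = 1 := by rw [← Real.exp_add]; norm_num
    have h8 : 0 < Real.exp 8 := Real.exp_pos _
    nlinarith
  have hε1 : ε ≤ 1 := by
    have : Real.exp (-8) ≤ 1 := by apply Real.exp_le_one_iff.mpr; norm_num
    linarith
  have hXe : Real.exp 8 ≤ X := by
    have : X = (k * q) * (1 / ε) := by rw [hX]; ring
    rw [this]
    have h4 : (1 : ℝ) ≤ k * q := by nlinarith
    have : 0 < 1 / ε := by positivity
    nlinarith
  have hX1 : (1001 : ℝ) ≤ X := he8.trans hXe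
  have hX0 : 0 < X := by linarith
  have hL8 : 8 ≤ L := by
    rw [hL, Real.le_log_iff_exp_le hX0]; exact hXe
  have hLX : L ≤ X := by
    have := Real.log_le_sub_one_of_pos hX0
    linarith
  have hY0 : 0 < Y := by rw [hY]; positivity
  have hLsq : 64 ≤ L ^ 2 := by nlinarith
  have hY1 : 1 ≤ Y := by
    rw [hY, le_div_iff₀ hε]
    have : (1 : ℝ) ≤ (q : ℝ) ^ 3 := one_le_pow₀ (by linarith)
    nlinarith
  refine ⟨by nlinarith, ?_⟩
  -- bounds in terms of X
  have hkX : (k : ℝ) ≤ X := by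
    rw [hX, le_div_iff₀ hε]; nlinarith
  have hYX : Y ≤ X ^ 3 := by
    rw [hX, hY, div_pow, div_le_div_iff₀ hε (by positivity)]
    have h1 : (k : ℝ) ≤ k ^ 3 := le_self_pow₀ (by linarith) (by norm_num)
    have h2 : ε ^ 3 ≤ ε := pow_le_of_le_one hε.le hε1 (by norm_num)
    calc (k : ℝ) * q ^ 3 * ε ^ 3 ≤ k ^ 3 * q ^ 3 * ε := by gcongr
      _ = _ := by ring
  have hsX : s ≤ X ^ 6 := by
    have h1 : Y * L ^ 2 ≤ X ^ 3 * X ^ 2 := by gcongr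
    have h2 : 1 ≤ Y * L ^ 2 := by nlinarith
    calc s ≤ 1001 * (Y * L ^ 2) := by linarith
      _ ≤ X * (X ^ 3 * X ^ 2) := by gcongr
      _ = X ^ 6 := by ring
  have hXL : X = Real.exp L := by rw [hL, Real.exp_log hX0]
  have hA : s ^ (q - 1) * (k * s ^ (q - 1)) * 4 ≤ Real.exp (12 * q * L) := by
    calc s ^ (q - 1) * (k * s ^ (q - 1)) * 4
        ≤ (X ^ 6) ^ (q - 1) * (X * (X ^ 6) ^ (q - 1)) * X := by
          gcongr
          linarith
      _ = X ^ (12 * (q - 1) + 2) := by rw [← pow_mul]; ring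
      _ ≤ X ^ (12 * q) := pow_le_pow_right₀ (by linarith) (by omega)
      _ = _ := by
        conv_lhs => rw [hXL, ← Real.exp_nat_mul]
        push_cast
        rfl
  have hB : 12 * q * L ≤ ε / (32 * k * q ^ 2) * (s / 2) := by
    have h1 : ε / (32 * k * q ^ 2) * (1000 * Y * L ^ 2 / 2) = 1000 / 64 * q * L ^ 2 := by
      rw [hY]; field_simp; norm_num
    have h2 : ε / (32 * k * q ^ 2) * (1000 * Y * L ^ 2 / 2) ≤
        ε / (32 * k * q ^ 2) * (s / 2) := by gcongr
    rw [h1] at h2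
    have h3 : (q : ℝ) * L * 8 ≤ q * L * L := by gcongr
    have h4 : 0 ≤ (q : ℝ) * L := by positivity
    nlinarith
  have hC : Real.exp (12 * q * L) * Real.exp (-(ε / (32 * k * q ^ 2) * (s / 2))) ≤ 1 := by
    rw [← Real.exp_add]
    apply Real.exp_le_one_iff.mpr
    linarith
  have hE : 0 < Real.exp (-(ε / (32 * k * q ^ 2) * (s / 2))) := Real.exp_pos _
  have := mul_le_mul_of_nonneg_right hA hE.le
  linarith

lemma geom_third (R : ℕ) : ∑ r ∈ Finset.Icc 1 R, ((1 : ℝ) / 4) ^ r ≤ 1 / 3 := by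
  have h : ∀ R : ℕ, ∑ r ∈ Finset.Icc 1 R, ((1 : ℝ) / 4) ^ r = 1 / 3 - 1 / 3 * (1 / 4) ^ R := by
    intro R
    induction R with
    | zero => simp
    | succ R ih =>
      rw [Finset.sum_Icc_succ_top (by omega), ih]
      ring
  rw [h]
  have : (0 : ℝ) ≤ (1 / 4) ^ R := by positivity
  linarith

end Helpers

/-- **Testing satisfiability.** There are absolute constants `c, c' > 0` such that for all
`n, q, k ≥ 2` with `c'·q ≤ n`, all `ε ∈ (0, e^{-8})`, and `s = ⌈c·(k·q³/ε)·ln²(kq/ε)⌉ ≤ n`: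
(i) if `φ` is satisfiable then `φ[S]` is satisfiable for every `s`-element set `S`; and
(ii) if `φ` is `ε`-far from satisfiable, then the fraction of `s`-element subsets `S` for
which `φ[S]` is satisfiable is at most `1/3`. -/
theorem sat_testing :
    ∃ c c' : ℝ, 0 < c ∧ 0 < c' ∧
      ∀ (n q k : ℕ) (ε : ℝ) (φ : CSP n q k) (s : ℕ),
        2 ≤ n → 2 ≤ q → 2 ≤ k →
        c' * (q : ℝ) ≤ (n : ℝ) →
        0 < ε → ε < Real.exp (-8) →
        s = ⌈c * ((k : ℝ) * (q : ℝ) ^ 3 / ε) * (Real.log ((k : ℝ) * (q : ℝ) / ε)) ^ 2⌉₊ →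
        s ≤ n →
        ((φ.Satisfiable → ∀ S : Finset (Fin n), S.card = s → φ.SatOn S) ∧
          (φ.EpsFar ε →
            ((((Finset.univ : Finset (Fin n)).powersetCard s).filter
                (fun S => φ.SatOn S)).card : ℝ) ≤ (n.choose s : ℝ) / 3)) := by
  refine ⟨1000, 1, by norm_num, by norm_num, ?_⟩
  intro n q k ε φ s hn hq hk _ hε hε8 hs hsn
  refine ⟨?_, ?_⟩
  · rintro ⟨A, hA⟩ S _
    exact ⟨A, fun c hc _ => hA c hc⟩
  intro hfar
  have hq' : (2 : ℝ) ≤ q := by exact_mod_cast hq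
  have hk' : (2 : ℝ) ≤ k := by exact_mod_cast hk
  have hn' : (0 : ℝ) < n := by exact_mod_cast (by omega : 0 < n)
  have hs1 : 1000 * ((k : ℝ) * (q : ℝ) ^ 3 / ε) * (Real.log ((k : ℝ) * (q : ℝ) / ε)) ^ 2
      ≤ (s : ℝ) := by rw [hs]; exact Nat.le_ceil _
  have hs2 : (s : ℝ) ≤
      1000 * ((k : ℝ) * (q : ℝ) ^ 3 / ε) * (Real.log ((k : ℝ) * (q : ℝ) / ε)) ^ 2 + 1 := by
    rw [hs]
    exact (Nat.ceil_lt_add_one (by positivity)).le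
  obtain ⟨hsY, hbase⟩ := base_small q k ε s hq hk hε hε8 (by positivity) hs1 hs2
  have hε1 : ε ≤ 1 := by
    have : Real.exp (-8) ≤ 1 := by apply Real.exp_le_one_iff.mpr; norm_num
    linarith
  set Y : ℝ := (k : ℝ) * (q : ℝ) ^ 3 / ε with hY
  have hq3Y : (q : ℝ) ^ 3 ≤ Y := by
    rw [hY, le_div_iff₀ hε]
    have : (0 : ℝ) ≤ (q : ℝ) ^ 3 := by positivity
    nlinarith
  have hq2Y : (q : ℝ) ^ 2 ≤ Y := le_trans (pow_le_pow_right₀ (by linarith) (by norm_num)) hq3Y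
  have hqY : (q : ℝ) ≤ Y := le_trans (le_self_pow₀ (by linarith) (by norm_num)) hq3Y
  have hY1 : 1 ≤ Y := by linarith
  have hspos : 0 < s := by
    have : (0 : ℝ) < s := by linarith
    exact_mod_cast this
  have hnq : 2 * q ^ 2 ≤ n := by
    have h1 : (s : ℝ) ≤ n := by exact_mod_cast hsn
    have : (2 : ℝ) * (q : ℝ) ^ 2 ≤ n := by linarith
    exact_mod_cast this
  set R : ℕ := ⌈8 * (k : ℝ) * q ^ 2 / ε⌉₊ with hR
  set η : ℝ := ε / (32 * k * q ^ 2) with hη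
  have hη0 : 0 < η := by positivity
  have hRl : 8 * (k : ℝ) * q ^ 2 / ε ≤ R := Nat.le_ceil _
  have hRu : (R : ℝ) ≤ 8 * (k : ℝ) * q ^ 2 / ε + 1 := (Nat.ceil_lt_add_one (by positivity)).le
  have hR0 : (0 : ℝ) < R := lt_of_lt_of_le (by positivity) hRl
  have hR1 : 1 ≤ R := by
    have : 0 < R := by exact_mod_cast hR0
    omega
  have hRq : (R : ℝ) * q ≤ 9 * Y := by
    have h1 : (8 * (k : ℝ) * q ^ 2 / ε + 1) * q = 8 * Y + q := by
      rw [hY]; field_simp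
    have : (R : ℝ) * q ≤ (8 * (k : ℝ) * q ^ 2 / ε + 1) * q := by gcongr
    linarith
  have hlt : (n : ℝ) ^ q / (q - 2).factorial * (k / R + η * (k + 1)) < ε * n.choose q := by
    have h1 : (k : ℝ) / R ≤ ε / (8 * q ^ 2) := by
      rw [div_le_div_iff₀ hR0 (by positivity)]
      rw [div_le_iff₀ hε] at hRl
      linarith
    have h2 : η * (k + 1) ≤ ε / (16 * q ^ 2) := by
      have : η * (k + 1) ≤ η * (2 * k) := by gcongr; linarith
      refine this.trans (le_of_eq ?_)
      rw [hη]; field_simp; norm_num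
    have h3 : (k : ℝ) / R + η * (k + 1) ≤ 3 / 16 * (ε / q ^ 2) := by
      have : ε / (8 * (q : ℝ) ^ 2) + ε / (16 * q ^ 2) = 3 / 16 * (ε / q ^ 2) := by
        field_simp; norm_num
      linarith
    have h4 := choose_lower hq hnq
    have hfpos : (0 : ℝ) < (q - 2).factorial := by exact_mod_cast Nat.factorial_pos _
    have h5 : (q.factorial : ℝ) ≤ q ^ 2 * (q - 2).factorial := by
      have : q.factorial ≤ q ^ 2 * (q - 2).factorial := by
        obtain ⟨p, rfl⟩ : ∃ p, q = p + 2 := ⟨q - 2, by omega⟩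
        rw [Nat.factorial_succ, Nat.factorial_succ, Nat.add_sub_cancel]
        have : 0 < p.factorial := Nat.factorial_pos _
        nlinarith
      exact_mod_cast this
    have hch : (0 : ℝ) < n.choose q := by
      exact_mod_cast Nat.choose_pos (by nlinarith)
    have h6 : (n : ℝ) ^ q / (q - 2).factorial ≤ 2 * q ^ 2 * n.choose q := by
      rw [div_le_iff₀ hfpos]
      have := mul_le_mul_of_nonneg_right h5 hch.le
      linarith
    calc (n : ℝ) ^ q / (q - 2).factorial * (k / R + η * (k + 1))
        ≤ (2 * q ^ 2 * n.choose q) * (3 / 16 * (ε / q ^ 2)) := by gcongr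
      _ = 3 / 8 * (ε * n.choose q) := by field_simp; norm_num
      _ < ε * n.choose q := by
        have : 0 < ε * n.choose q := by positivity
        linarith
  -- cover by rounds
  let bad : ℕ → Finset (Finset (Fin n)) := fun r =>
    ((Finset.univ : Finset (Fin n)).powersetCard s).filter
      (fun S => ∃ Q ⊆ S, Q.card ≤ r * (q - 1) ∧ ∃ C ∈ reach φ Q r,
      Disjoint S (Finset.univ.filter (fun x => C x = ∅)) ∧
      (r : ℝ) * η * n ≤ ((Finset.univ.filter (fun x => C x = ∅)).card : ℝ))
  have hsub : (((Finset.univ : Finset (Fin n)).powersetCard s).filter (fun S => φ.SatOn S)) ⊆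
      (Finset.Icc 1 R).biUnion bad := by
    intro S hS
    obtain ⟨hS1, hS2⟩ := Finset.mem_filter.mp hS
    have hSc := (Finset.mem_powersetCard.mp hS1).2
    obtain ⟨r, hr1, hr2, h⟩ := det_main φ hq S (Finset.card_pos.mp (by omega)) hS2 ε η hη0.le
      hfar R hR1 hlt
    exact Finset.mem_biUnion.mpr ⟨r, Finset.mem_Icc.mpr ⟨hr1, hr2⟩,
      Finset.mem_filter.mpr ⟨hS1, h⟩⟩
  have hbad : ∀ r ∈ Finset.Icc 1 R, ((bad r).card : ℝ) ≤ n.choose s * (1 / 4) ^ r := by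
    intro r hr
    obtain ⟨hr1, hr2⟩ := Finset.mem_Icc.mp hr
    have ht : ((r * (q - 1) : ℕ) : ℝ) ≤ 9 * Y := by
      have h1 : r * (q - 1) ≤ R * q := Nat.mul_le_mul hr2 (by omega)
      have h2 : ((r * (q - 1) : ℕ) : ℝ) ≤ R * q := by exact_mod_cast h1
      linarith
    have hts2 : 2 * (r * (q - 1)) + 1 ≤ s := by
      have : 2 * ((r * (q - 1) : ℕ) : ℝ) + 1 ≤ s := by linarith
      exact_mod_cast this
    have h := count_round φ (by omega) hq s r (r * (q - 1)) (by omega) (r * η * n)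
    refine h.trans ?_
    apply mul_le_mul_of_nonneg_left _ (by positivity)
    have e1 : (s.choose (r * (q - 1)) : ℝ) ≤ ((s : ℝ) ^ (q - 1)) ^ r := by
      rw [← pow_mul, mul_comm (q - 1)]
      exact_mod_cast Nat.choose_le_pow s (r * (q - 1))
    have e2 : ((k : ℝ) * (((r * (q - 1) : ℕ) : ℝ) + 1) ^ (q - 1)) ^ r ≤
        ((k : ℝ) * (s : ℝ) ^ (q - 1)) ^ r := by
      have : (((r * (q - 1) : ℕ) : ℝ) + 1) ≤ s := by
        exact_mod_cast (by omega : r * (q - 1) + 1 ≤ s)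
      gcongr
    have e3 : Real.exp (-((r : ℝ) * η * n / n)) ^ (s - r * (q - 1)) ≤
        Real.exp (-(η * ((s : ℝ) / 2))) ^ r := by
      rw [← Real.exp_nat_mul, ← Real.exp_nat_mul]
      apply Real.exp_le_exp.mpr
      rw [mul_div_assoc, div_self hn'.ne', mul_one, Nat.cast_sub (by omega)]
      have h1 : 2 * ((r * (q - 1) : ℕ) : ℝ) + 1 ≤ s := by exact_mod_cast hts2
      have h2 : (s : ℝ) / 2 ≤ s - ((r * (q - 1) : ℕ) : ℝ) := by linarith
      have h3 : (r : ℝ) * η * (s / 2) ≤ r * η * (s - ((r * (q - 1) : ℕ) : ℝ)) := by gcongr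
      linarith
    calc _ ≤ ((s : ℝ) ^ (q - 1)) ^ r * ((k : ℝ) * (s : ℝ) ^ (q - 1)) ^ r *
          Real.exp (-(η * ((s : ℝ) / 2))) ^ r := by gcongr
      _ = ((s : ℝ) ^ (q - 1) * (k * (s : ℝ) ^ (q - 1)) * Real.exp (-(η * ((s : ℝ) / 2)))) ^ r := by
        rw [← mul_pow, ← mul_pow]
      _ ≤ (1 / 4) ^ r := by gcongr
  calc _ ≤ (((Finset.Icc 1 R).biUnion bad).card : ℝ) := by
        exact_mod_cast Finset.card_le_card hsub
    _ ≤ ∑ r ∈ Finset.Icc 1 R, ((bad r).card : ℝ) := by exact_mod_cast Finset.card_biUnion_le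
    _ ≤ ∑ r ∈ Finset.Icc 1 R, (n.choose s : ℝ) * (1 / 4) ^ r := Finset.sum_le_sum hbad
    _ = n.choose s * ∑ r ∈ Finset.Icc 1 R, ((1 : ℝ) / 4) ^ r := by rw [Finset.mul_sum]
    _ ≤ n.choose s * (1 / 3) := by gcongr; exact geom_third R
    _ = _ := by ring
end

section
/- There exists an absolute constant c > 0 such that the following holds. Let n, k ≥ 1 be integers, let ε ∈ (0, e^{-8}), and set s = ⌈c·(k/ε)·ln²(k/ε)⌉, assuming s ≤ n. Let Π be a semi-homogeneous k-partition property, let G be a graph on n vertices, and let S be a uniformly random s-element subset of its vertices. Then: (i) if G has property Π, the induced subgraph G[S] has property Π; and (ii) if G is ε-far from Π, then the probability that G[S] has property Π is at most 1/3. (Consequently the sample complexity of ε-testing any property in k-SHPP is O((k/ε)·ln²(k/ε)).) -/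
open Finset
open scoped Classical

/-- The unordered pair `{v, w}` (read in the order `(v, w)`) violates the partition `f` for
the semi-homogeneous `k`-partition property with parameters `l, u : Fin k → Fin k → Bool`:
either `u_{f v, f w} = 0` but `v, w` are adjacent, or `l_{f v, f w} = 1` but they are not. -/
def IsViolating {n k : ℕ} (l u : Fin k → Fin k → Bool) (G : SimpleGraph (Fin n))
    (f : Fin n → Fin k) (v w : Fin n) : Prop :=
  (u (f v) (f w) = false ∧ G.Adj v w) ∨ (l (f v) (f w) = true ∧ ¬ G.Adj v w)

/-- `G` has the semi-homogeneous `k`-partition property with parameters `l, u`: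
some partition (coloring) `f` of the vertices has no violating pair. -/
def HasSHPP {n k : ℕ} (l u : Fin k → Fin k → Bool) (G : SimpleGraph (Fin n)) : Prop :=
  ∃ f : Fin n → Fin k, ∀ v w : Fin n, v ≠ w → ¬ IsViolating l u G f v w

/-- The induced subgraph `G[S]` has the semi-homogeneous `k`-partition property. -/
def HasSHPPOn {n k : ℕ} (l u : Fin k → Fin k → Bool) (G : SimpleGraph (Fin n))
    (S : Finset (Fin n)) : Prop :=
  ∃ f : Fin n → Fin k, ∀ v ∈ S, ∀ w ∈ S, v ≠ w → ¬ IsViolating l u G f v w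

/-- `G` is `ε`-far from the semi-homogeneous `k`-partition property: for every partition,
at least `ε·n²` unordered pairs violate it (counted here as `2·ε·n²` ordered pairs). -/
def EpsFarSHPP {n k : ℕ} (l u : Fin k → Fin k → Bool) (G : SimpleGraph (Fin n))
    (ε : ℝ) : Prop :=
  ∀ f : Fin n → Fin k,
    2 * (ε * (n : ℝ) ^ 2) ≤
      (((Finset.univ : Finset (Fin n)).offDiag.filter
          (fun p => IsViolating l u G f p.1 p.2 ∨ IsViolating l u G f p.2 p.1)).card : ℝ)

section Containers

variable {X : Type*} [Fintype X]

/-- One phase of the container algorithm. -/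
lemma shpp_phase (R : X → X → Prop) (D : ℝ) (hD : 0 ≤ D) :
    ∀ (m : ℕ) (C : Finset X), C.card = m → ∃ P T : Finset X → Finset X, ∀ A : Finset X,
      T A ⊆ A ∧ P A ⊆ C ∧ (∀ x ∈ P A, (((P A).filter (R x)).card : ℝ) ≤ D) ∧
      ((T A).card : ℝ) * D ≤ (C.card : ℝ) - ((P A).card : ℝ) ∧
      (∀ B, T A ⊆ B → B ⊆ A → P B = P A) ∧
      ((∀ x ∈ A, ∀ y ∈ A, ¬ R x y) → A ⊆ C → A ⊆ P A) := by
  intro m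
  induction m using Nat.strong_induction_on with
  | _ m ih =>
    intro C hC
    by_cases h : ∀ x ∈ C, ((C.filter (R x)).card : ℝ) ≤ D
    · exact ⟨fun _ => C, fun _ => ∅, fun A => ⟨by simp, by simp, h, by simp, by simp,
        fun _ h => h⟩⟩
    · push Not at h
      obtain ⟨x, hx, hxd⟩ := h
      have hpos : 0 < (C.filter (R x)).card := by
        have : (0 : ℝ) < ((C.filter (R x)).card : ℝ) := lt_of_le_of_lt hD hxd
        exact_mod_cast this
      have hcard : (C.filter (fun y => ¬ R x y)).card + (C.filter (R x)).card = C.card := by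
        rw [add_comm]; exact Finset.card_filter_add_card_filter_not (R x)
      have hcardR : ((C.filter (fun y => ¬ R x y)).card : ℝ) + ((C.filter (R x)).card : ℝ)
          = (C.card : ℝ) := by exact_mod_cast hcard
      have herase : ((C.erase x).card : ℝ) ≤ (C.card : ℝ) := by
        exact_mod_cast Finset.card_erase_le
      obtain ⟨P1, T1, h1⟩ := ih _ (by omega) (C.filter (fun y => ¬ R x y)) rfl
      obtain ⟨P2, T2, h2⟩ := ih _ (by rw [← hC]; exact Finset.card_erase_lt_of_mem hx)
        (C.erase x) rfl
      refine ⟨fun A => if x ∈ A then P1 A else P2 A,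
        fun A => if x ∈ A then insert x (T1 A) else T2 A, fun A => ?_⟩
      by_cases hA : x ∈ A
      · obtain ⟨a1, a2, a3, a4, a5, a6⟩ := h1 A
        simp only [hA, if_true]
        refine ⟨?_, a2.trans (Finset.filter_subset _ _), a3, ?_, ?_, ?_⟩
        · exact Finset.insert_subset hA a1
        · have : ((insert x (T1 A)).card : ℝ) ≤ ((T1 A).card : ℝ) + 1 := by
            exact_mod_cast Finset.card_insert_le _ _
          nlinarith
        · intro B hB hBA
          have hxB : x ∈ B := hB (Finset.mem_insert_self _ _)
          simp only [hxB, if_true]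
          exact a5 B ((Finset.subset_insert _ _).trans hB) hBA
        · intro hI hAC
          apply a6 hI
          intro y hy
          exact Finset.mem_filter.2 ⟨hAC hy, hI x hA y hy⟩
      · obtain ⟨a1, a2, a3, a4, a5, a6⟩ := h2 A
        simp only [hA, if_false]
        refine ⟨a1, a2.trans (Finset.erase_subset _ _), a3, ?_, ?_, ?_⟩
        · linarith
        · intro B hB hBA
          have hxB : x ∉ B := fun h => hA (hBA h)
          simp only [hxB, if_false]
          exact a5 B hB hBA
        · intro hI hAC
          apply a6 hI
          intro y hy
          exact Finset.mem_erase.2 ⟨fun h => hA (h ▸ hy), hAC hy⟩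

/-- The nested containers at a decreasing sequence of scales. -/
lemma shpp_containers (R : X → X → Prop) (D : ℕ → ℝ) (hD : ∀ j, 0 ≤ D j)
    (hanti : ∀ j, D (j + 1) ≤ D j)
    (h0 : (Fintype.card X : ℝ) ≤ D 0) :
    ∃ P T : ℕ → Finset X → Finset X, ∀ A : Finset X,
      P 0 A = Finset.univ ∧
      ∀ j, T j A ⊆ A ∧ P (j + 1) A ⊆ P j A ∧
      (∀ x ∈ P j A, (((P j A).filter (R x)).card : ℝ) ≤ D j) ∧
      ((T j A).card : ℝ) * D j ≤ (Fintype.card X : ℝ) - ((P j A).card : ℝ) ∧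
      (∀ B, T j A ⊆ B → B ⊆ A → P j B = P j A) ∧
      ((∀ x ∈ A, ∀ y ∈ A, ¬ R x y) → A ⊆ P j A) := by
  have key : ∀ (j : ℕ) (C : Finset X), _ := fun j C => shpp_phase R (D j) (hD j) C.card C rfl
  choose p t hpt using key
  let P : ℕ → Finset X → Finset X := fun j => Nat.rec (fun _ => Finset.univ)
    (fun j r A => p (j + 1) (r A) A) j
  have P0 : ∀ A, P 0 A = Finset.univ := fun A => rfl
  have PS : ∀ j A, P (j + 1) A = p (j + 1) (P j A) A := fun j A => rfl
  let T : ℕ → Finset X → Finset X := fun j => Nat.rec (fun _ => ∅)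
    (fun j r A => r A ∪ t (j + 1) (P j A) A) j
  have T0 : ∀ A, T 0 A = ∅ := fun A => rfl
  have TS : ∀ j A, T (j + 1) A = T j A ∪ t (j + 1) (P j A) A := fun j A => rfl
  refine ⟨P, T, fun A => ⟨P0 A, fun j => ?_⟩⟩
  have hsub : P (j + 1) A ⊆ P j A := by rw [PS]; exact (hpt (j + 1) (P j A) A).2.1
  clear_value P T
  suffices hh : T j A ⊆ A ∧ 
      (∀ x ∈ P j A, (((P j A).filter (R x)).card : ℝ) ≤ D j) ∧
      ((T j A).card : ℝ) * D j ≤ (Fintype.card X : ℝ) - ((P j A).card : ℝ) ∧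
      (∀ B, T j A ⊆ B → B ⊆ A → P j B = P j A) ∧
      ((∀ x ∈ A, ∀ y ∈ A, ¬ R x y) → A ⊆ P j A) from
    ⟨hh.1, hsub, hh.2⟩
  clear hsub
  induction j with
  | zero =>
    refine ⟨by simp [T0], ?_, by simp [T0, P0], by simp [P0], by simp [P0]⟩
    intro x _
    refine le_trans ?_ h0
    exact_mod_cast Finset.card_le_univ _
  | succ j ih =>
    obtain ⟨a1, a2, a3, a4, a5⟩ := ih
    obtain ⟨b1, b2, b3, b4, b5, b6⟩ := hpt (j + 1) (P j A) A
    refine ⟨?_, ?_, ?_, ?_, ?_⟩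
    · rw [TS]; exact Finset.union_subset a1 b1
    · rw [PS]; exact b3
    · rw [TS, PS]
      have : ((T j A ∪ t (j + 1) (P j A) A).card : ℝ) ≤
          ((T j A).card : ℝ) + ((t (j + 1) (P j A) A).card : ℝ) := by
        exact_mod_cast Finset.card_union_le _ _
      have h1 := mul_le_mul_of_nonneg_right this (hD (j + 1))
      have h2 := mul_le_mul_of_nonneg_left (hanti j) (Nat.cast_nonneg (α := ℝ) (T j A).card)
      linarith
    · intro B hB hBA
      rw [TS] at hB
      rw [PS, PS, a4 B (Finset.union_subset_left hB) hBA]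
      exact b5 B (Finset.union_subset_right hB) hBA
    · intro hI
      rw [PS]
      exact b6 hI (a5 hI)

end Containers

lemma shpp_choose (m e : ℕ) (δ : ℝ) (hδ : 0 ≤ δ) (he : δ * m ≤ e) (r : ℕ) :
    ((m - e).choose r : ℝ) ≤ (m.choose r : ℝ) * Real.exp (-(δ * r)) := by
  have key : ((m - e).descFactorial r : ℝ) ≤ (m.descFactorial r : ℝ) * Real.exp (-(δ * r)) := by
    induction r with
    | zero => simp
    | succ r ih =>
      rw [Nat.descFactorial_succ, Nat.descFactorial_succ]
      have hexp : Real.exp (-(δ * ((r + 1 : ℕ) : ℝ))) =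
          Real.exp (-δ) * Real.exp (-(δ * r)) := by
        rw [← Real.exp_add]; push_cast; ring_nf
      have h1 : ((m - e - r : ℕ) : ℝ) ≤ ((m - r : ℕ) : ℝ) * Real.exp (-δ) := by
        by_cases h : e + r ≤ m
        · have h2 : (((m - e - r : ℕ) : ℝ)) = m - e - r := by
            rw [Nat.sub_sub, Nat.cast_sub h]; push_cast; ring
          have h3 : (((m - r : ℕ) : ℝ)) = m - r := by
            rw [Nat.cast_sub (by omega)]
          have h4 := Real.add_one_le_exp (-δ)
          have h5 : (0 : ℝ) ≤ (m : ℝ) - r := by rw [← h3]; positivity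
          rw [h2, h3]
          have h6 : (0 : ℝ) ≤ δ * r := by positivity
          nlinarith [mul_le_mul_of_nonneg_left h4 h5]
        · have : m - e - r = 0 := by omega
          rw [this]; push_cast; positivity
      push_cast at hexp ⊢
      rw [hexp]
      calc ((m - e - r : ℕ) : ℝ) * ((m - e).descFactorial r : ℝ)
          ≤ (((m - r : ℕ) : ℝ) * Real.exp (-δ)) *
            ((m.descFactorial r : ℝ) * Real.exp (-(δ * r))) := by gcongr
        _ = _ := by ring
  rw [Nat.descFactorial_eq_factorial_mul_choose, Nat.descFactorial_eq_factorial_mul_choose] at key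
  push_cast at key
  have hf : (0 : ℝ) < (r.factorial : ℝ) := by exact_mod_cast r.factorial_pos
  rw [mul_assoc] at key
  exact le_of_mul_le_mul_left key hf

lemma shpp_countS (n s : ℕ) (T E : Finset (Fin n)) (δ : ℝ) (hδ : 0 ≤ δ)
    (hE : δ * n ≤ E.card) :
    ((((Finset.univ : Finset (Fin n)).powersetCard s).filter
      (fun S => T ⊆ S ∧ Disjoint S E)).card : ℝ) ≤
      ((n - T.card).choose (s - T.card) : ℝ) * Real.exp (-(δ * ((s - T.card : ℕ) : ℝ))) := by
  by_cases hTE : Disjoint T E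
  · have h1 : ((((Finset.univ : Finset (Fin n)).powersetCard s).filter
      (fun S => T ⊆ S ∧ Disjoint S E)).card) ≤
        ((Finset.univ \ (T ∪ E)).powersetCard (s - T.card)).card := by
      apply Finset.card_le_card_of_injOn (fun S => S \ T)
      · intro S hS
        simp only [Finset.coe_filter, Finset.mem_powersetCard, Set.mem_ofPred_eq] at hS
        obtain ⟨⟨-, hc⟩, hT, hd⟩ := hS
        simp only [Finset.mem_coe, Finset.mem_powersetCard]
        refine ⟨?_, ?_⟩
        · intro v hv
          rw [Finset.mem_sdiff] at hv
          simp only [Finset.mem_sdiff, Finset.mem_univ, Finset.mem_union, true_and, not_or]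
          exact ⟨hv.2, Finset.disjoint_left.1 hd hv.1⟩
        · rw [Finset.card_sdiff_of_subset hT, hc]
      · intro S hS S' hS' h
        simp only [Finset.coe_filter, Finset.mem_powersetCard, Set.mem_ofPred_eq] at hS hS'
        have h' : S \ T = S' \ T := h
        rw [← Finset.sdiff_union_of_subset hS.2.1, h', Finset.sdiff_union_of_subset hS'.2.1]
    have h2 : (Finset.univ \ (T ∪ E)).card = n - T.card - E.card := by
      rw [Finset.card_sdiff_of_subset (Finset.subset_univ _), Finset.card_union_of_disjoint hTE,
        Finset.card_univ, Fintype.card_fin, Nat.sub_sub]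
    rw [Finset.card_powersetCard, h2] at h1
    refine le_trans (by exact_mod_cast h1) (shpp_choose (n - T.card) E.card δ hδ ?_ _)
    refine le_trans ?_ hE
    have : ((n - T.card : ℕ) : ℝ) ≤ n := by exact_mod_cast Nat.sub_le _ _
    gcongr
  · have : (((Finset.univ : Finset (Fin n)).powersetCard s).filter
      (fun S => T ⊆ S ∧ Disjoint S E)) = ∅ := by
      apply Finset.filter_eq_empty_iff.2
      rintro S - ⟨h1, h2⟩
      exact hTE (h2.mono_left h1)
    rw [this]
    simp only [Finset.card_empty, Nat.cast_zero]
    positivity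

/-- The conflict relation on vertex-color pairs. -/
def shppR {n k : ℕ} (l u : Fin k → Fin k → Bool) (G : SimpleGraph (Fin n))
    (x y : Fin n × Fin k) : Prop :=
  x.1 ≠ y.1 ∧ (((u x.2 y.2 = false ∧ G.Adj x.1 y.1) ∨ (l x.2 y.2 = true ∧ ¬ G.Adj x.1 y.1)) ∨
    ((u y.2 x.2 = false ∧ G.Adj y.1 x.1) ∨ (l y.2 x.2 = true ∧ ¬ G.Adj y.1 x.1)))

lemma shppR_symm {n k : ℕ} (l u : Fin k → Fin k → Bool) (G : SimpleGraph (Fin n))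
    (x y : Fin n × Fin k) (h : shppR l u G x y) : shppR l u G y x :=
  ⟨h.1.symm, h.2.symm⟩

/-- The vertices with no color left in the container. -/
noncomputable def shppE {n k : ℕ} (C : Finset (Fin n × Fin k)) : Finset (Fin n) :=
  Finset.univ.filter (fun v => ∀ i, (v, i) ∉ C)

/-- Nested containers for an `ε`-far graph: some level has many uncolorable vertices. -/
lemma shpp_level {n k N : ℕ} (l u : Fin k → Fin k → Bool) (G : SimpleGraph (Fin n)) (ε : ℝ)
    (hn : 1 ≤ n) (hk : 1 ≤ k) (hε : 0 < ε) (hN : 1 ≤ N) (hN2 : 2 * ((k : ℝ) / ε) ≤ 2 ^ N)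
    (hfar : EpsFarSHPP l u G ε) (P : ℕ → Finset (Fin n × Fin k))
    (hP0 : P 0 = Finset.univ) (hanti : ∀ j, P (j + 1) ⊆ P j)
    (hdeg : ∀ j, ∀ x ∈ P j, (((P j).filter (shppR l u G x)).card : ℝ) ≤ (k * n : ℝ) / 2 ^ j) :
    ∃ j ∈ Finset.Icc 1 N, ε * 2 ^ j / (4 * k * N) * n ≤ ((shppE (P j)).card : ℝ) := by
  by_contra hcon
  push Not at hcon
  have hnR : (0 : ℝ) < n := by exact_mod_cast hn
  have hkR : (0 : ℝ) < k := by exact_mod_cast hk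
  have hNR : (0 : ℝ) < N := by exact_mod_cast hN
  have hmono : ∀ i j, i ≤ j → P j ⊆ P i := fun i j h =>
    antitone_nat_of_succ_le (f := P) hanti h
  -- rank and coloring
  have hex : ∀ v : Fin n, ∃ r : ℕ, ∃ i : Fin k, r ≤ N ∧ (v, i) ∈ P r ∧
      (r < N → v ∈ shppE (P (r + 1))) := by
    intro v
    have hne : ∃ i : Fin k, (v, i) ∈ P 0 := ⟨⟨0, hk⟩, by simp [hP0]⟩
    let Q : ℕ → Prop := fun r => ∃ i : Fin k, (v, i) ∈ P r
    have hspec : Q (Nat.findGreatest Q N) := Nat.findGreatest_spec (Nat.zero_le N) hne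
    obtain ⟨i, hi⟩ := hspec
    refine ⟨Nat.findGreatest Q N, i, Nat.findGreatest_le N, hi, fun hlt => ?_⟩
    have : ¬ Q (Nat.findGreatest Q N + 1) :=
      Nat.findGreatest_is_greatest (Nat.lt_succ_self _) hlt
    simp only [shppE, Finset.mem_filter, Finset.mem_univ, true_and]
    intro i hi
    exact this ⟨i, hi⟩
  choose r f hrN hfP hrE using hex
  have hf := hfar f
  set Dg : Fin n → ℝ := fun v => (k * n : ℝ) / 2 ^ (r v) with hDg
  -- bound on the number of violating pairs
  have hA : ((((Finset.univ : Finset (Fin n)).offDiag.filter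
          (fun p => IsViolating l u G f p.1 p.2 ∨ IsViolating l u G f p.2 p.1)).card : ℝ)) ≤
        2 * ∑ v, Dg v := by
    let W : Fin n → Finset (Fin n) := fun v =>
      Finset.univ.filter (fun w => shppR l u G (v, f v) (w, f w) ∧ r v ≤ r w)
    have hW : ∀ v, ((W v).card : ℝ) ≤ Dg v := by
      intro v
      refine le_trans ?_ (hdeg (r v) (v, f v) (hfP v))
      norm_cast
      apply Finset.card_le_card_of_injOn (fun w => (w, f w))
      · intro w hw
        simp only [W, Finset.coe_filter, Finset.mem_univ, true_and, Set.mem_ofPred_eq] at hw ⊢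
        exact ⟨hmono _ _ hw.2 (hfP w), hw.1⟩
      · intro a _ b _ h
        exact (Prod.ext_iff.1 h).1
    have hsub : ((Finset.univ : Finset (Fin n)).offDiag.filter
          (fun p => IsViolating l u G f p.1 p.2 ∨ IsViolating l u G f p.2 p.1)) ⊆
        (Finset.univ.biUnion fun v => (W v).image (fun w => (v, w))) ∪
        (Finset.univ.biUnion fun v => (W v).image (fun w => (w, v))) := by
      rintro ⟨v, w⟩ hvw
      simp only [Finset.mem_filter, Finset.mem_offDiag, Finset.mem_univ, true_and] at hvw
      have hR : shppR l u G (v, f v) (w, f w) := ⟨hvw.1, hvw.2⟩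
      simp only [Finset.mem_union, Finset.mem_biUnion, Finset.mem_univ, true_and,
        Finset.mem_image, Prod.mk.injEq, W, Finset.mem_filter]
      rcases le_total (r v) (r w) with h | h
      · exact Or.inl ⟨v, w, ⟨hR, h⟩, rfl, rfl⟩
      · exact Or.inr ⟨w, v, ⟨shppR_symm _ _ _ _ _ hR, h⟩, rfl, rfl⟩
    have hc : (((Finset.univ : Finset (Fin n)).offDiag.filter
          (fun p => IsViolating l u G f p.1 p.2 ∨ IsViolating l u G f p.2 p.1)).card) ≤
        ∑ v, (W v).card + ∑ v, (W v).card := by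
      refine (Finset.card_le_card hsub).trans ((Finset.card_union_le _ _).trans ?_)
      gcongr
      · exact Finset.card_biUnion_le.trans (Finset.sum_le_sum fun v _ => Finset.card_image_le)
      · exact Finset.card_biUnion_le.trans (Finset.sum_le_sum fun v _ => Finset.card_image_le)
    have hc' : ((((Finset.univ : Finset (Fin n)).offDiag.filter
          (fun p => IsViolating l u G f p.1 p.2 ∨ IsViolating l u G f p.2 p.1)).card : ℝ)) ≤
        ∑ v, ((W v).card : ℝ) + ∑ v, ((W v).card : ℝ) := by exact_mod_cast hc
    have := Finset.sum_le_sum (s := Finset.univ) fun v _ => hW v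
    linarith
  -- bound on the sum of degrees
  have hB : ∑ v, Dg v ≤ ∑ j ∈ Finset.range N,
      ((shppE (P (j + 1))).card : ℝ) * ((k * n : ℝ) / 2 ^ j) + n * ((k * n : ℝ) / 2 ^ N) := by
    have h1 : ∀ v, Dg v ≤ ∑ j ∈ Finset.range N,
        (if v ∈ shppE (P (j + 1)) then (k * n : ℝ) / 2 ^ j else 0) + (k * n : ℝ) / 2 ^ N := by
      intro v
      have hnn : ∀ j ∈ Finset.range N,
          (0 : ℝ) ≤ (if v ∈ shppE (P (j + 1)) then (k * n : ℝ) / 2 ^ j else 0) := by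
        intro j _; split_ifs <;> positivity
      rcases lt_or_eq_of_le (hrN v) with h | h
      · have h2 := Finset.single_le_sum hnn (Finset.mem_range.2 h)
        rw [if_pos (hrE v h)] at h2
        have h3 : (0 : ℝ) ≤ (k * n : ℝ) / 2 ^ N := by positivity
        simp only [hDg]; linarith
      · have := Finset.sum_nonneg hnn
        simp only [hDg, h]; linarith
    refine (Finset.sum_le_sum fun v _ => h1 v).trans (le_of_eq ?_)
    rw [Finset.sum_add_distrib, Finset.sum_comm]
    congr 1
    · apply Finset.sum_congr rfl
      intro j _
      rw [← Finset.sum_filter, Finset.sum_const, nsmul_eq_mul]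
      congr 3
      ext v; simp
    · simp
  have hC : ∑ j ∈ Finset.range N,
      ((shppE (P (j + 1))).card : ℝ) * ((k * n : ℝ) / 2 ^ j) < ε * n ^ 2 / 2 := by
    have : ∑ j ∈ Finset.range N, ((shppE (P (j + 1))).card : ℝ) * ((k * n : ℝ) / 2 ^ j) <
        ∑ j ∈ Finset.range N, ε * n ^ 2 / (2 * N) := by
      apply Finset.sum_lt_sum_of_nonempty ⟨0, Finset.mem_range.2 hN⟩
      intro j hj
      have h1 := hcon (j + 1) (Finset.mem_Icc.2 ⟨by omega, Finset.mem_range.1 hj⟩)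
      have h2 : (0 : ℝ) < (k * n : ℝ) / 2 ^ j := by positivity
      refine (mul_lt_mul_of_pos_right h1 h2).trans_eq ?_
      field_simp
      ring
    refine this.trans_eq ?_
    rw [Finset.sum_const, Finset.card_range, nsmul_eq_mul]
    field_simp
  have hD : (n : ℝ) * ((k * n : ℝ) / 2 ^ N) ≤ ε * n ^ 2 / 2 := by
    have h1 : 2 * (k : ℝ) ≤ ε * 2 ^ N := by
      have : 2 * ((k : ℝ) / ε) = (2 * k) / ε := by ring
      rw [this, div_le_iff₀ hε] at hN2
      linarith
    rw [← mul_div_assoc, div_le_iff₀ (by positivity)]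
    nlinarith [mul_le_mul_of_nonneg_right h1 (sq_nonneg (n : ℝ))]
  linarith

/-- The counting bound. -/
lemma shpp_count {n k N s : ℕ} (l u : Fin k → Fin k → Bool) (G : SimpleGraph (Fin n)) (ε : ℝ)
    (hn : 1 ≤ n) (hk : 1 ≤ k) (hε : 0 < ε) (hN : 1 ≤ N) (hN2 : 2 * ((k : ℝ) / ε) ≤ 2 ^ N)
    (hsN : 2 ^ N ≤ s) (hs : s ≤ n)
    (hfar : EpsFarSHPP l u G ε) :
    ((((Finset.univ : Finset (Fin n)).powersetCard s).filter
                (fun S => HasSHPPOn l u G S)).card : ℝ) ≤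
      ∑ j ∈ Finset.Icc 1 N, ∑ t ∈ Finset.range (2 ^ j + 1),
        (n.choose t : ℝ) * ((k : ℝ) ^ t * (((n - t).choose (s - t) : ℝ) *
          Real.exp (-(ε * 2 ^ j / (4 * k * N) * ((s - t : ℕ) : ℝ))))) := by
  have hnR : (0 : ℝ) < n := by exact_mod_cast hn
  have hkR : (0 : ℝ) < k := by exact_mod_cast hk
  have hNR : (0 : ℝ) < N := by exact_mod_cast hN
  obtain ⟨P, T, hPT⟩ := shpp_containers (shppR l u G) (fun j => (k * n : ℝ) / 2 ^ j)
    (fun j => by positivity)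
    (fun j => by
      apply div_le_div_of_nonneg_left (by positivity) (by positivity)
      exact pow_le_pow_right₀ (by norm_num) (Nat.le_succ j))
    (by simp [mul_comm])
  let δ : ℕ → ℝ := fun j => ε * 2 ^ j / (4 * k * N)
  have hδ : ∀ j, 0 ≤ δ j := fun j => by positivity
  let C : (j : ℕ) → (T' : Finset (Fin n)) → ((a : Fin n) → a ∈ T' → Fin k) →
      Finset (Fin n × Fin k) := fun j T' g => P j (T'.attach.image (fun v => (v.1, g v.1 v.2)))
  let F : (j : ℕ) → (T' : Finset (Fin n)) → ((a : Fin n) → a ∈ T' → Fin k) →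
      Finset (Finset (Fin n)) := fun j T' g =>
    if δ j * n ≤ ((shppE (C j T' g)).card : ℝ) then
      ((Finset.univ : Finset (Fin n)).powersetCard s).filter
        (fun S => T' ⊆ S ∧ Disjoint S (shppE (C j T' g))) else ∅
  have hF : ∀ j T' g, ((F j T' g).card : ℝ) ≤ ((n - T'.card).choose (s - T'.card) : ℝ) *
      Real.exp (-(δ j * ((s - T'.card : ℕ) : ℝ))) := by
    intro j T' g
    by_cases h : δ j * n ≤ ((shppE (C j T' g)).card : ℝ)
    · simp only [F, if_pos h]
      exact shpp_countS n s T' _ _ (hδ j) h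
    · simp only [F, if_neg h, Finset.card_empty, Nat.cast_zero]
      positivity
  have hsub : (((Finset.univ : Finset (Fin n)).powersetCard s).filter
                (fun S => HasSHPPOn l u G S)) ⊆
      (Finset.Icc 1 N).biUnion fun j => (Finset.range (2 ^ j + 1)).biUnion fun t =>
        ((Finset.univ : Finset (Fin n)).powersetCard t).biUnion fun T' =>
          (T'.pi fun _ => (Finset.univ : Finset (Fin k))).biUnion fun g => F j T' g := by
    intro S hS
    rw [Finset.mem_filter] at hS
    obtain ⟨hSs, f, hf⟩ := hS
    let A : Finset (Fin n × Fin k) := S.image (fun v => (v, f v))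
    have hind : ∀ x ∈ A, ∀ y ∈ A, ¬ shppR l u G x y := by
      intro x hx y hy hR
      obtain ⟨v, hv, rfl⟩ := Finset.mem_image.1 hx
      obtain ⟨w, hw, rfl⟩ := Finset.mem_image.1 hy
      rcases hR.2 with h | h
      · exact hf v hv w hw hR.1 h
      · exact hf w hw v hv hR.1.symm h
    obtain ⟨hP0, hPj⟩ := hPT A
    obtain ⟨j, hj, hE⟩ := shpp_level l u G ε hn hk hε hN hN2 hfar (fun j => P j A) hP0
      (fun j => (hPj j).2.1) (fun j => (hPj j).2.2.1)
    obtain ⟨a1, -, -, a4, a5, a6⟩ := hPj j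
    have hTmem : ∀ x ∈ T j A, x.1 ∈ S ∧ x.2 = f x.1 := by
      intro x hx
      obtain ⟨v, hv, rfl⟩ := Finset.mem_image.1 (a1 hx)
      exact ⟨hv, rfl⟩
    have hcard : (T j A).card ≤ 2 ^ j := by
      have h1 : ((T j A).card : ℝ) * ((k * n : ℝ) / 2 ^ j) ≤ k * n := by
        refine a4.trans ?_
        have : (0 : ℝ) ≤ ((P j A).card : ℝ) := by positivity
        simp only [Fintype.card_prod, Fintype.card_fin]
        push_cast
        nlinarith
      have h2 : ((T j A).card : ℝ) ≤ 2 ^ j := by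
        rw [← mul_div_assoc, div_le_iff₀ (by positivity), mul_comm (k * n : ℝ)] at h1
        exact le_of_mul_le_mul_right h1 (by positivity)
      exact_mod_cast h2
    let T' := (T j A).image Prod.fst
    have hT'c : T'.card ≤ 2 ^ j := Finset.card_image_le.trans hcard
    have hTeq : T'.attach.image (fun v => (v.1, f v.1)) = T j A := by
      ext x
      simp only [Finset.mem_image, Finset.mem_attach, true_and, Subtype.exists, T']
      constructor
      · rintro ⟨v, ⟨y, hy, rfl⟩, rfl⟩
        rw [← (hTmem y hy).2]
        exact hy
      · intro hx
        refine ⟨x.1, ⟨x, hx, rfl⟩, ?_⟩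
        rw [← (hTmem x hx).2]
    have hCeq : C j T' (fun a _ => f a) = P j A := by
      simp only [C]
      rw [hTeq]
      exact a5 _ subset_rfl a1
    simp only [Finset.mem_biUnion]
    refine ⟨j, hj, T'.card, Finset.mem_range.2 (by omega), T',
      Finset.mem_powersetCard.2 ⟨Finset.subset_univ _, rfl⟩, fun a _ => f a, by simp, ?_⟩
    simp only [F]
    rw [hCeq, if_pos hE, Finset.mem_filter]
    refine ⟨hSs, ?_, ?_⟩
    · intro v hv
      obtain ⟨x, hx, rfl⟩ := Finset.mem_image.1 hv
      exact (hTmem x hx).1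
    · rw [Finset.disjoint_left]
      intro v hv hvE
      rw [shppE, Finset.mem_filter] at hvE
      exact hvE.2 (f v) (a6 hind (Finset.mem_image_of_mem _ hv))
  have hc : ∀ {α : Type} (I : Finset α) (φ : α → Finset (Finset (Fin n))) (b : α → ℝ),
      (∀ i ∈ I, ((φ i).card : ℝ) ≤ b i) → ((I.biUnion φ).card : ℝ) ≤ ∑ i ∈ I, b i := by
    intro α I φ b h
    refine le_trans ?_ (Finset.sum_le_sum h)
    exact_mod_cast Finset.card_biUnion_le
  refine le_trans (Nat.cast_le.2 (Finset.card_le_card hsub)) ?_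
  refine hc _ _ _ fun j _ => hc _ _ _ fun t _ => ?_
  have : (n.choose t : ℝ) * ((k : ℝ) ^ t * (((n - t).choose (s - t) : ℝ) *
          Real.exp (-(δ j * ((s - t : ℕ) : ℝ))))) =
      ∑ T' ∈ (Finset.univ : Finset (Fin n)).powersetCard t,
        ∑ g ∈ (T'.pi fun _ => (Finset.univ : Finset (Fin k))),
        (((n - T'.card).choose (s - T'.card) : ℝ) *
          Real.exp (-(δ j * ((s - T'.card : ℕ) : ℝ)))) := by
    have h1 : ∀ T' ∈ (Finset.univ : Finset (Fin n)).powersetCard t,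
        ∑ g ∈ (T'.pi fun _ => (Finset.univ : Finset (Fin k))),
        (((n - T'.card).choose (s - T'.card) : ℝ) *
          Real.exp (-(δ j * ((s - T'.card : ℕ) : ℝ)))) =
        (k : ℝ) ^ t * (((n - t).choose (s - t) : ℝ) *
          Real.exp (-(δ j * ((s - t : ℕ) : ℝ)))) := by
      intro T' hT'
      rw [Finset.sum_const, Finset.card_pi, (Finset.mem_powersetCard.1 hT').2, nsmul_eq_mul]
      simp [(Finset.mem_powersetCard.1 hT').2]
    rw [Finset.sum_congr rfl h1, Finset.sum_const, Finset.card_powersetCard, nsmul_eq_mul]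
    simp
  refine le_trans ?_ (le_of_eq this.symm)
  refine hc _ _ _ fun T' _ => hc _ _ _ fun g _ => ?_
  have hfinal := hF j T' g
  exact hfinal

/-- Numerical estimate of one level. -/
lemma shpp_term {n k N s j : ℕ} (ε Q : ℝ) (hk : 1 ≤ k) (hε : 0 < ε) (hN : 1 ≤ N)
    (hs1 : 1 ≤ s) (hjs : 2 * 2 ^ j ≤ s) (hs : s ≤ n) (hQ0 : 0 ≤ Q)
    (hQ : 1 + Real.log (s * k) + Q ≤ s / (8 * ((k : ℝ) / ε) * N)) :
    ∑ t ∈ Finset.range (2 ^ j + 1),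
        (n.choose t : ℝ) * ((k : ℝ) ^ t * (((n - t).choose (s - t) : ℝ) *
          Real.exp (-(ε * 2 ^ j / (4 * k * N) * ((s - t : ℕ) : ℝ))))) ≤
      (n.choose s : ℝ) * Real.exp (-Q) := by
  have hkR : (1 : ℝ) ≤ k := by exact_mod_cast hk
  have hNR : (0 : ℝ) < N := by exact_mod_cast hN
  have hsR : (1 : ℝ) ≤ s := by exact_mod_cast hs1
  have hsk : (1 : ℝ) ≤ s * k := by nlinarith
  have hjsR : 2 * (2 : ℝ) ^ j ≤ s := by exact_mod_cast hjs
  set M : ℝ := (n.choose s : ℝ) * ((s * k : ℝ) ^ (2 ^ j) *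
    Real.exp (-(ε * 2 ^ j / (4 * k * N) * (s / 2)))) with hM
  have h1 : ∀ t ∈ Finset.range (2 ^ j + 1),
      (n.choose t : ℝ) * ((k : ℝ) ^ t * (((n - t).choose (s - t) : ℝ) *
          Real.exp (-(ε * 2 ^ j / (4 * k * N) * ((s - t : ℕ) : ℝ))))) ≤ M := by
    intro t ht
    have ht' : t ≤ 2 ^ j := by have := Finset.mem_range.1 ht; omega
    have hts : t ≤ s := by omega
    have e1 : (n.choose t : ℝ) * ((n - t).choose (s - t) : ℝ) =
        (n.choose s : ℝ) * (s.choose t : ℝ) := by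
      have := Nat.choose_mul (n := n) hts
      exact_mod_cast this.symm
    have e2 : (s.choose t : ℝ) ≤ (s : ℝ) ^ t := by exact_mod_cast Nat.choose_le_pow s t
    have e3 : (s / 2 : ℝ) ≤ ((s - t : ℕ) : ℝ) := by
      rw [Nat.cast_sub hts]
      have : (t : ℝ) ≤ 2 ^ j := by exact_mod_cast ht'
      linarith
    have e4 : Real.exp (-(ε * 2 ^ j / (4 * k * N) * ((s - t : ℕ) : ℝ))) ≤
        Real.exp (-(ε * 2 ^ j / (4 * k * N) * (s / 2))) := by
      apply Real.exp_le_exp.2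
      apply neg_le_neg
      apply mul_le_mul_of_nonneg_left e3
      positivity
    have e5 : (s : ℝ) ^ t * (k : ℝ) ^ t ≤ (s * k : ℝ) ^ (2 ^ j) := by
      rw [← mul_pow]; exact pow_le_pow_right₀ hsk ht'
    calc _ = ((n.choose t : ℝ) * ((n - t).choose (s - t) : ℝ)) * ((k : ℝ) ^ t *
          Real.exp (-(ε * 2 ^ j / (4 * k * N) * ((s - t : ℕ) : ℝ)))) := by ring
      _ = (n.choose s : ℝ) * (((s.choose t : ℝ) * (k : ℝ) ^ t) *
          Real.exp (-(ε * 2 ^ j / (4 * k * N) * ((s - t : ℕ) : ℝ)))) := by rw [e1]; ring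
      _ ≤ (n.choose s : ℝ) * (((s : ℝ) ^ t * (k : ℝ) ^ t) *
          Real.exp (-(ε * 2 ^ j / (4 * k * N) * (s / 2)))) := by gcongr
      _ ≤ M := by rw [hM]; gcongr
  refine (Finset.sum_le_sum h1).trans ?_
  rw [Finset.sum_const, Finset.card_range, nsmul_eq_mul, hM]
  have h2 : (((2 ^ j + 1 : ℕ)) : ℝ) ≤ Real.exp (2 ^ j) := by
    push_cast; exact Real.add_one_le_exp _
  have h3 : (s * k : ℝ) ^ (2 ^ j) = Real.exp (2 ^ j * Real.log (s * k)) := by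
    have : (2 : ℝ) ^ j = ((2 ^ j : ℕ) : ℝ) := by push_cast; rfl
    rw [this, Real.exp_nat_mul, Real.exp_log (by linarith)]
  have h4 : ε * 2 ^ j / (4 * k * N) * (s / 2) = 2 ^ j * (s / (8 * ((k : ℝ) / ε) * N)) := by
    field_simp
    ring
  rw [h3, h4]
  have h5 : (1 : ℝ) ≤ 2 ^ j := one_le_pow₀ (by norm_num)
  calc _ ≤ Real.exp (2 ^ j) * ((n.choose s : ℝ) * (Real.exp (2 ^ j * Real.log (s * k)) *
        Real.exp (-(2 ^ j * (s / (8 * ((k : ℝ) / ε) * N)))))) := by gcongr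
    _ = (n.choose s : ℝ) * Real.exp (2 ^ j * (1 + Real.log (s * k) -
          (s / (8 * ((k : ℝ) / ε) * N)))) := by
        rw [show (2 : ℝ) ^ j * (1 + Real.log (s * k) - (s / (8 * ((k : ℝ) / ε) * N))) =
          2 ^ j + (2 ^ j * Real.log (s * k) + -(2 ^ j * (s / (8 * ((k : ℝ) / ε) * N)))) by ring,
          Real.exp_add, Real.exp_add]
        ring
    _ ≤ _ := by
        gcongr
        have h6 : 1 + Real.log (s * k) - (s / (8 * ((k : ℝ) / ε) * N)) ≤ -Q := by linarith
        have := mul_le_mul_of_nonneg_left h6 (by positivity : (0 : ℝ) ≤ 2 ^ j)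
        nlinarith

/-- Choice of the number of levels. -/
lemma shpp_N (K : ℝ) (hK : Real.exp 8 ≤ K) :
    ∃ N : ℕ, 1 ≤ N ∧ 2 * K ≤ 2 ^ N ∧ (2 : ℝ) ^ N ≤ 4 * K ∧ (N : ℝ) ≤ 2 * Real.log K := by
  have hK0 : 0 < K := (Real.exp_pos 8).trans_le hK
  have h8 : 8 ≤ Real.log K := (Real.le_log_iff_exp_le hK0).2 hK
  have hK1 : 1 ≤ K := le_trans (by have := Real.add_one_le_exp (8 : ℝ); linarith) hK
  obtain ⟨m, hm1, hm2⟩ := exists_nat_pow_near (x := 2 * K) (y := 2) (by linarith) (by norm_num)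
  refine ⟨m + 1, by omega, hm2.le, by rw [pow_succ]; linarith, ?_⟩
  have h1 : (m : ℝ) * Real.log 2 ≤ Real.log 2 + Real.log K := by
    rw [← Real.log_pow, ← Real.log_mul (by norm_num) hK0.ne']
    exact Real.log_le_log (by positivity) hm1
  have := Real.log_two_gt_d9
  push_cast
  nlinarith

/-- **Testing semi-homogeneous partition properties.** There is an absolute constant `c > 0`
such that for all `n, k ≥ 1`, `ε ∈ (0, e^{-8})`, every semi-homogeneous `k`-partition
property `Π` given by `{0,1}` matrices `l ≤ u`, and `s = ⌈c·(k/ε)·ln²(k/ε)⌉ ≤ n`: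
(i) if `G` has `Π` then `G[S]` has `Π` for every `s`-element set `S`; and (ii) if `G` is
`ε`-far from `Π`, the fraction of `s`-element subsets `S` for which `G[S]` has `Π` is at
most `1/3`. -/
theorem shpp_testing :
    ∃ c : ℝ, 0 < c ∧
      ∀ (n k : ℕ) (ε : ℝ) (l u : Fin k → Fin k → Bool) (G : SimpleGraph (Fin n)) (s : ℕ),
        1 ≤ n → 1 ≤ k →
        0 < ε → ε < Real.exp (-8) →
        (∀ i j : Fin k, l i j = true → u i j = true) →
        s = ⌈c * ((k : ℝ) / ε) * (Real.log ((k : ℝ) / ε)) ^ 2⌉₊ →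
        s ≤ n →
        ((HasSHPP l u G → ∀ S : Finset (Fin n), S.card = s → HasSHPPOn l u G S) ∧
          (EpsFarSHPP l u G ε →
            ((((Finset.univ : Finset (Fin n)).powersetCard s).filter
                (fun S => HasSHPPOn l u G S)).card : ℝ) ≤ (n.choose s : ℝ) / 3)) := by
  refine ⟨1000, by norm_num, ?_⟩
  intro n k ε l u G s hn hk hε hε8 hlu hs hsn
  refine ⟨fun ⟨f, hf⟩ S _ => ⟨f, fun v _ w _ => hf v w⟩, fun hfar => ?_⟩
  have hkR : (1 : ℝ) ≤ k := by exact_mod_cast hk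
  set K : ℝ := (k : ℝ) / ε with hKdef
  have hε1 : ε < 1 := hε8.trans (by rw [Real.exp_lt_one_iff]; norm_num)
  have hkK : (k : ℝ) ≤ K := by
    rw [hKdef, le_div_iff₀ hε]; nlinarith
  have hK : Real.exp 8 ≤ K := by
    rw [hKdef, le_div_iff₀ hε]
    have : Real.exp 8 * ε ≤ Real.exp 8 * Real.exp (-8) := by gcongr
    rw [← Real.exp_add] at this
    norm_num at this
    linarith
  have hK0 : 0 < K := (Real.exp_pos 8).trans_le hK
  have h8 : 8 ≤ Real.log K := (Real.le_log_iff_exp_le hK0).2 hK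
  have hK2000 : 2000 ≤ K := by
    refine le_trans ?_ hK
    have : Real.exp 8 = (Real.exp 1) ^ 8 := by rw [← Real.exp_nat_mul]; norm_num
    rw [this]
    have h27 : (2.7 : ℝ) ≤ Real.exp 1 := by have := Real.exp_one_gt_d9; linarith
    calc (2000 : ℝ) ≤ 2.7 ^ 8 := by norm_num
      _ ≤ _ := by gcongr
  have hlogK : Real.log K ≤ K := (Real.log_le_sub_one_of_pos hK0).trans (by linarith)
  obtain ⟨N, hN1, hN2, hN3, hN4⟩ := shpp_N K hK
  have hNR : (1 : ℝ) ≤ N := by exact_mod_cast hN1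
  set L := Real.log K with hL
  have hs_lo : 1000 * K * L ^ 2 ≤ s := by rw [hs]; exact Nat.le_ceil _
  have hs_hi : (s : ℝ) ≤ 1000 * K * L ^ 2 + 1 := by
    rw [hs]; exact (Nat.ceil_lt_add_one (by positivity)).le
  have hL2 : (64 : ℝ) ≤ L ^ 2 := by nlinarith
  have hs64 : 8 * K ≤ s := by nlinarith
  have hNs : 2 * 2 ^ N ≤ s := by
    have : 2 * (2 : ℝ) ^ N ≤ s := by linarith
    exact_mod_cast this
  have hs1R : (1 : ℝ) ≤ s := by linarith
  have hs1 : 1 ≤ s := by exact_mod_cast hs1R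
  have hlog_sk : Real.log (s * k) ≤ 5 * L := by
    have h1 : (s * k : ℝ) ≤ K ^ 5 := by
      have a1 : L ^ 2 ≤ K ^ 2 := by gcongr
      have a2 : (s : ℝ) ≤ 2000 * K ^ 3 := by
        have : 1000 * K * L ^ 2 ≤ 1000 * K * K ^ 2 := by gcongr
        have h3 : (1 : ℝ) ≤ K ^ 3 := one_le_pow₀ (by linarith)
        nlinarith
      calc (s * k : ℝ) ≤ (2000 * K ^ 3) * K := by gcongr
        _ ≤ (K * K ^ 3) * K := by gcongr
        _ = K ^ 5 := by ring
    have h2 := Real.log_le_log (by positivity) h1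
    rw [Real.log_pow] at h2
    exact_mod_cast h2
  have hlog3N : Real.log (3 * N) ≤ 6 * L := by
    have h1 := Real.log_le_sub_one_of_pos (show (0 : ℝ) < 3 * N by linarith)
    linarith
  have hlog3N0 : 0 ≤ Real.log (3 * N) := Real.log_nonneg (by linarith)
  have hQ : 1 + Real.log (s * k) + Real.log (3 * N) ≤ s / (8 * ((k : ℝ) / ε) * N) := by
    rw [← hKdef, le_div_iff₀ (by positivity)]
    calc _ ≤ (12 * L) * (8 * K * (2 * L)) := by
          gcongr
          linarith
      _ ≤ 1000 * K * L ^ 2 := by nlinarith [mul_pos hK0 (by linarith : 0 < L ^ 2)]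
      _ ≤ s := hs_lo
  refine (shpp_count l u G ε hn hk hε hN1 hN2 (by omega) hsn hfar).trans ?_
  have hsum : ∀ j ∈ Finset.Icc 1 N, _ := fun j hj =>
    shpp_term (n := n) (j := j) ε (Real.log (3 * N)) hk hε hN1 hs1
      (by
        have : 2 ^ j ≤ 2 ^ N := Nat.pow_le_pow_right (by norm_num) (Finset.mem_Icc.1 hj).2
        omega) hsn hlog3N0 hQ
  refine (Finset.sum_le_sum hsum).trans (le_of_eq ?_)
  rw [Finset.sum_const, Nat.card_Icc, nsmul_eq_mul, Real.exp_neg, Real.exp_log (by linarith)]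
  simp only [Nat.add_sub_cancel]
  field_simp
end
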